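/- Let G be a finite group with the basis property whose order is not a prime power. Then there exist distinct primes p and q and subgroups P and Q of G such that P is a normal Sylow p-subgroup, Q is a non-trivial cyclic Sylow q-subgroup, P ∩ Q = 1, PQ = G, and every non-trivial element of Q acts fixed-point-freely on P by conjugation. -/

import Mathlib

/-- A subset `X` of a group `G` is a minimal generating set if it generates `G`
and no proper subset of `X` generates `G`. -/
def IsMinimalGenSet {G : Type*} [Group G] (X : Set G) : Prop :=
  Subgroup.closure X = ⊤ ∧ ∀ Y : Set G, Y ⊂ X → Subgroup.closure Y ≠ ⊤

/-- A group has property `B` if all its minimal generating sets have the same size. -/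
def HasPropB (G : Type*) [Group G] : Prop :=
  ∀ X Y : Set G, IsMinimalGenSet X → IsMinimalGenSet Y → X.ncard = Y.ncard

/-- `dGen G` is the smallest size of a minimal generating set of `G`. -/
noncomputable def dGen (G : Type*) [Group G] : ℕ :=
  sInf {n | ∃ X : Set G, IsMinimalGenSet X ∧ X.ncard = n}

/-- `mGen G` is the largest size of a minimal generating set of `G`. -/
noncomputable def mGen (G : Type*) [Group G] : ℕ :=
  sSup {n | ∃ X : Set G, IsMinimalGenSet X ∧ X.ncard = n}

namespace BasisProperty

open Subgroup

/-- A set is irredundant if no element lies in the subgroup generated by the others. -/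
def Irredundant {G : Type*} [Group G] (X : Set G) : Prop :=
  ∀ x ∈ X, x ∉ closure (X \ {x})

/-- Irredundant sets have the least size among the sets generating the same subgroup. -/
def RelBasis (G : Type*) [Group G] : Prop :=
  ∀ X Y : Set G, Irredundant X → closure X = closure Y → X.ncard ≤ Y.ncard

section Basic

variable {G : Type*} [Group G]

theorem Irredundant.image {H : Type*} [Group H] {f : H →* G} (hf : Function.Injective f)
    {X : Set H} (hX : Irredundant X) : Irredundant (f '' X) := by
  rintro _ ⟨x, hx, rfl⟩ h
  rw [← Set.image_singleton, ← Set.image_sdiff hf, ← MonoidHom.map_closure] at h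
  obtain ⟨y, hy, hxy⟩ := h
  exact hX x hx (hf hxy ▸ hy)

theorem exists_irredundant_subset [Finite G] (Y : Set G) :
    ∃ X ⊆ Y, Irredundant X ∧ closure X = closure Y := by
  obtain ⟨X, hXY, hX⟩ := exists_minimal_le_of_wellFoundedLT
    (fun X : Set G ↦ closure X = closure Y) Y rfl
  refine ⟨X, hXY, fun x hx h ↦ ?_, hX.prop⟩
  have h1 : closure (X \ {x}) = closure Y := by
    rw [← hX.prop]
    refine le_antisymm (closure_mono Set.sdiff_subset) ((closure_le _).2 fun y hy ↦ ?_)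
    by_cases hyx : y = x
    · exact hyx ▸ h
    · exact subset_closure ⟨hy, hyx⟩
  exact (hX.le_of_le h1 Set.sdiff_subset hx).2 rfl

theorem Irredundant.isMinimalGenSet {X : Set G} {H : Subgroup G} (hX : Irredundant X)
    (hH : closure X = H) : IsMinimalGenSet ((↑) ⁻¹' X : Set H) := by
  subst hH
  refine ⟨closure_closure_coe_preimage, fun Y hY h ↦ ?_⟩
  obtain ⟨x, hxX, hxY⟩ := Set.exists_of_ssubset hY
  apply hX x hxX
  have h1 : (closure Y).map (closure X).subtype = closure X := by
    rw [h, ← MonoidHom.range_eq_map, range_subtype]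
  have h2 : (x : G) ∈ (closure Y).map (closure X).subtype := by rw [h1]; exact x.2
  rw [MonoidHom.map_closure] at h2
  refine closure_mono ?_ h2
  rintro _ ⟨y, hy, rfl⟩
  refine ⟨hY.1 hy, fun h ↦ hxY ?_⟩
  rwa [← Subtype.ext h]

theorem ncard_preimage_coe {X : Set G} {H : Subgroup G} (hX : X ⊆ H) :
    ((↑) ⁻¹' X : Set H).ncard = X.ncard := by
  apply Set.ncard_preimage_of_injective_subset_range Subtype.val_injective
  simpa using hX

theorem relBasis_of_hasPropB [Finite G] (h : ∀ H : Subgroup G, HasPropB H) : RelBasis G := by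
  intro X Y hX hXY
  obtain ⟨Z, hZY, hZ, hZc⟩ := exists_irredundant_subset Y
  have := h (closure X) _ _ (hX.isMinimalGenSet rfl) (hZ.isMinimalGenSet (hZc.trans hXY.symm))
  rw [ncard_preimage_coe subset_closure,
    ncard_preimage_coe (hXY ▸ hZY.trans subset_closure)] at this
  exact this.trans_le (Set.ncard_le_ncard hZY (Set.toFinite _))

theorem RelBasis.subgroup (h : RelBasis G) (H : Subgroup G) : RelBasis H := by
  intro X Y hX hXY
  have := h (H.subtype '' X) (H.subtype '' Y) (hX.image H.subtype_injective)
    (by rw [← MonoidHom.map_closure, ← MonoidHom.map_closure, hXY])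
  rwa [Set.ncard_image_of_injective _ H.subtype_injective,
    Set.ncard_image_of_injective _ H.subtype_injective] at this

theorem irredundant_pair {a b : G} (hab : a ∉ zpowers b) (hba : b ∉ zpowers a) :
    Irredundant {a, b} := by
  rintro x (rfl | rfl) h
  · refine hab ((closure_le (zpowers b)).2 ?_ h)
    rintro y ⟨rfl | rfl, h2⟩
    · exact absurd rfl h2
    · exact mem_zpowers _
  · refine hba ((closure_le (zpowers a)).2 ?_ h)
    rintro y ⟨rfl | rfl, h2⟩
    · exact mem_zpowers _
    · exact absurd rfl h2

theorem eq_one_of_commute [Finite G] (hG : RelBasis G) {a b : G} (hab : Commute a b)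
    (hc : (orderOf a).Coprime (orderOf b)) : a = 1 ∨ b = 1 := by
  by_contra! hne
  have hd : ∀ {x y : G}, x ∈ zpowers y → orderOf x ∣ orderOf y := by
    rintro x y ⟨k, rfl⟩
    exact orderOf_dvd_of_mem_zpowers ⟨k, rfl⟩
  have h1 : a ∉ zpowers b := fun h ↦ hne.1 (orderOf_eq_one_iff.1
    (Nat.eq_one_of_dvd_coprimes hc dvd_rfl (hd h)))
  have h2 : b ∉ zpowers a := fun h ↦ hne.2 (orderOf_eq_one_iff.1
    (Nat.eq_one_of_dvd_coprimes hc.symm dvd_rfl (hd h)))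
  have hane : a ≠ b := fun h ↦ h1 (h ▸ mem_zpowers _)
  have key : ∀ {x y : G}, Commute x y → (orderOf x).Coprime (orderOf y) →
      x ∈ zpowers (x * y) := by
    intro x y hxy hc
    obtain ⟨m, hm⟩ := exists_pow_eq_self_of_coprime hc.symm
    refine mem_zpowers_iff.2 ⟨(orderOf y * m : ℕ), ?_⟩
    rw [zpow_natCast, hxy.mul_pow, pow_mul, pow_mul, pow_orderOf_eq_one, one_pow, mul_one, hm]
  have := hG {a, b} {a * b} (irredundant_pair h1 h2) (by
    refine le_antisymm ((closure_le _).2 ?_) ((closure_le _).2 ?_)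
    · rw [← zpowers_eq_closure]
      rintro x (rfl | rfl)
      · exact key hab hc
      · exact hab.eq ▸ key hab.symm hc.symm
    · rintro x rfl
      exact mul_mem (subset_closure (by simp)) (subset_closure (by simp)))
  rw [Set.ncard_pair hane, Set.ncard_singleton] at this
  omega

theorem orderOf_eq_pow [Finite G] (hG : RelBasis G) {p : ℕ} (hp : p.Prime) {g : G}
    (h : p ∣ orderOf g) : ∃ k, orderOf g = p ^ k := by
  obtain ⟨k, m, hm, hk⟩ := Nat.exists_eq_pow_mul_and_not_dvd (orderOf_pos g).ne' p hp.ne_one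
  have hm0 : m ≠ 0 := by rintro rfl; simp at hm
  have ha : orderOf (g ^ m) = p ^ k := by
    rw [orderOf_pow_of_dvd hm0 (hk ▸ dvd_mul_left _ _), hk, Nat.mul_div_cancel _ (by omega)]
  have hb : orderOf (g ^ p ^ k) = m := by
    rw [orderOf_pow_of_dvd (pow_pos hp.pos _).ne' (hk ▸ dvd_mul_right _ _), hk,
      Nat.mul_div_cancel_left _ (pow_pos hp.pos _)]
  have hc : (p ^ k).Coprime m := Nat.Coprime.pow_left _ ((hp.coprime_iff_not_dvd).2 hm)
  rcases eq_one_of_commute hG (a := g ^ m) (b := g ^ p ^ k) ((Commute.refl g).pow_pow _ _)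
    (by rwa [ha, hb]) with h1 | h1
  · rw [h1, orderOf_one] at ha
    rw [← ha, one_mul] at hk
    exact absurd (hk ▸ h) hm
  · rw [h1, orderOf_one] at hb
    exact ⟨k, by rw [hk, ← hb, mul_one]⟩

theorem coprime_orderOf {p q : ℕ} (hp : p.Prime) (hq : q.Prime) (hpq : p ≠ q) {P Q : Subgroup G}
    (hP : IsPGroup p P) (hQ : IsPGroup q Q) {x y : G} (hx : x ∈ P) (hy : y ∈ Q) :
    (orderOf x).Coprime (orderOf y) := by
  have := Fact.mk hp
  have := Fact.mk hq
  obtain ⟨k, hk⟩ := IsPGroup.iff_orderOf.1 hP ⟨x, hx⟩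
  obtain ⟨l, hl⟩ := IsPGroup.iff_orderOf.1 hQ ⟨y, hy⟩
  rw [orderOf_mk] at hk hl
  rw [hk, hl]
  exact Nat.coprime_pow_primes _ _ hp hq hpq

end Basic

section Action

variable {G : Type*} [Group G]

theorem exists_mul_of_mem_sup {A V : Subgroup G} (hA : A ≤ normalizer V) {g : G}
    (hg : g ∈ A ⊔ V) : ∃ a ∈ A, ∃ v ∈ V, a * v = g := by
  have : g ∈ ((A ⊔ V : Subgroup G) : Set G) := hg
  rwa [coe_mul_of_left_le_normalizer_right _ _ hA] at this

theorem inf_eq_bot_of_irredundant [Finite G] (hG : RelBasis G) {V L : Subgroup G} {X : Set G}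
    (hL : L ≤ normalizer V) (hLV : L ⊓ V = ⊥) (hV : V ≠ ⊥) (hVc : V ≤ centralizer V)
    (hmin : ∀ W ≤ V, W ≠ ⊥ → L ≤ normalizer W → W = V)
    (hX : Irredundant X) (hXL : closure X = L) {x v : G} (hx : x ∈ X) (hv : v ∈ V) :
    closure (insert (x * v) (X \ {x})) ⊓ V = ⊥ := by
  by_contra hne
  set X' := insert (x * v) (X \ {x}) with hX'
  set H := closure X' with hH
  have hXL' : ∀ y ∈ X, y ∈ L := fun y hy ↦ hXL ▸ subset_closure hy
  have hxH : x * v ∈ H := subset_closure (Set.mem_insert _ _)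
  have hVN : V ≤ normalizer V := le_normalizer
  have hHN : H ≤ normalizer V := by
    refine (closure_le _).2 ?_
    rintro y (rfl | hy)
    · exact mul_mem (hL (hXL' x hx)) (hVN hv)
    · exact hL (hXL' y hy.1)
  have hVHN : V ≤ normalizer (H ⊓ V : Subgroup G) := by
    rw [le_normalizer_iff]
    intro w hw k hk
    rw [← mem_centralizer_iff.1 (hVc hw) k hk.2]
    simpa using hk
  have hHHN : H ≤ normalizer (H ⊓ V : Subgroup G) :=
    le_trans (le_inf le_normalizer hHN) inf_normalizer_le_normalizer_inf
  have hLN : L ≤ normalizer (H ⊓ V : Subgroup G) := by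
    rw [← hXL]
    refine (closure_le _).2 fun y hy ↦ ?_
    by_cases hyx : y = x
    · have : y = x * v * v⁻¹ := by simp [hyx]
      rw [this]
      exact mul_mem (hHHN hxH) (hVHN (inv_mem hv))
    · exact hHHN (subset_closure (Or.inr ⟨hy, hyx⟩))
  have hVH : V ≤ H := inf_eq_right.1 (hmin _ inf_le_right hne hLN)
  have hXH : L ≤ H := by
    rw [← hXL]
    refine (closure_le _).2 fun y hy ↦ ?_
    by_cases hyx : y = x
    · have : y = x * v * v⁻¹ := by simp [hyx]
      rw [this]
      exact mul_mem hxH (hVH (inv_mem hv))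
    · exact subset_closure (Or.inr ⟨hy, hyx⟩)
  have hHsup : H = L ⊔ V := by
    refine le_antisymm ((closure_le _).2 ?_) (sup_le hXH hVH)
    rintro y (rfl | hy)
    · exact mul_mem (mem_sup_left (hXL' x hx)) (mem_sup_right hv)
    · exact mem_sup_left (hXL' y hy.1)
  obtain ⟨Z, hZX, hZ, hZc⟩ := exists_irredundant_subset (X ∪ V)
  rw [Subgroup.closure_union, closure_eq, hXL] at hZc
  have hXZ : X ⊆ Z := by
    intro y hy
    by_contra hyZ
    have hAL : closure (X \ {y}) ≤ L := by
      rw [← hXL]; exact closure_mono Set.sdiff_subset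
    have h1 : closure Z ≤ closure (X \ {y}) ⊔ V := by
      refine (closure_le _).2 fun z hz ↦ ?_
      rcases hZX hz with h | h
      · exact mem_sup_left (subset_closure ⟨h, by rintro rfl; exact hyZ hz⟩)
      · exact mem_sup_right h
    have h2 : y ∈ closure (X \ {y}) ⊔ V := h1 (hZc ▸ mem_sup_left (hXL' y hy))
    obtain ⟨a, ha, w, hw, hay⟩ := exists_mul_of_mem_sup (hAL.trans hL) h2
    have hwL : w ∈ L := by
      have : w = a⁻¹ * y := by rw [← hay]; group
      rw [this]
      exact mul_mem (inv_mem (hAL ha)) (hXL' y hy)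
    have hw1 : w ∈ L ⊓ V := ⟨hwL, hw⟩
    rw [hLV, mem_bot] at hw1
    rw [hw1, mul_one] at hay
    exact hX y hy (hay ▸ ha)
  have hXneZ : X ≠ Z := by
    rintro rfl
    rw [hXL] at hZc
    apply hV
    rw [← hLV, eq_comm, inf_eq_right, hZc]
    exact le_sup_right
  have h1 := Set.ncard_lt_ncard (hXZ.ssubset_of_ne hXneZ) (Set.toFinite _)
  have h2 := hG Z X' hZ (hZc.trans hHsup.symm)
  have h3 : X'.ncard ≤ (X \ {x}).ncard + 1 := Set.ncard_insert_le _ _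
  have h4 := Set.ncard_sdiff_singleton_add_one hx (Set.toFinite _)
  omega

theorem exists_minimal_invariant [Finite G] {p : ℕ} (hp : p.Prime) {V₀ L : Subgroup G}
    (hV₀ : IsPGroup p V₀) (hne : V₀ ≠ ⊥) (hL : L ≤ normalizer V₀) :
    ∃ V ≤ V₀, V ≠ ⊥ ∧ L ≤ normalizer V ∧ V ≤ centralizer V ∧
      ∀ W ≤ V, W ≠ ⊥ → L ≤ normalizer W → W = V := by
  have := Fact.mk hp
  obtain ⟨V, hVV, hV⟩ := exists_minimal_le_of_wellFoundedLT
    (fun V : Subgroup G ↦ V ≠ ⊥ ∧ L ≤ normalizer V) V₀ ⟨hne, hL⟩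
  have hmin : ∀ W ≤ V, W ≠ ⊥ → L ≤ normalizer W → W = V := fun W hW h1 h2 ↦
    le_antisymm hW (hV.le_of_le ⟨h1, h2⟩ hW)
  refine ⟨V, hVV, hV.prop.1, hV.prop.2, ?_, hmin⟩
  rw [← inf_eq_left]
  refine hmin _ inf_le_left ?_ ?_
  · have hVp : IsPGroup p V := hV₀.to_le hVV
    have : Nontrivial V := (nontrivial_iff_ne_bot V).2 hV.prop.1
    have := hVp.center_nontrivial
    obtain ⟨z, hz⟩ := exists_ne (1 : center V)
    intro hbot
    apply hz
    have h1 : ((z : V) : G) ∈ V ⊓ centralizer V := by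
      refine ⟨(z : V).2, mem_centralizer_iff.2 fun h hh ↦ ?_⟩
      exact congrArg Subtype.val (mem_center_iff.1 z.2 ⟨h, hh⟩)
    rw [hbot, mem_bot] at h1
    exact Subtype.ext (Subtype.ext h1)
  · refine le_trans (le_inf hV.prop.2 (hV.prop.2.trans ?_)) inf_normalizer_le_normalizer_inf
    intro g hg
    rw [mem_normalizer_iff]
    have key : ∀ g ∈ normalizer (V : Set G), ∀ h ∈ centralizer (V : Set G),
        g * h * g⁻¹ ∈ centralizer (V : Set G) := by
      intro g hg h hh
      rw [mem_centralizer_iff] at hh ⊢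
      intro v hv
      have := hh _ ((mem_normalizer_iff''.1 hg v).1 hv)
      calc v * (g * h * g⁻¹) = g * ((g⁻¹ * v * g) * h) * g⁻¹ := by group
        _ = g * (h * (g⁻¹ * v * g)) * g⁻¹ := by rw [this]
        _ = _ := by group
    refine fun h ↦ ⟨key g hg h, fun hh ↦ ?_⟩
    have := key _ (inv_mem hg) _ hh
    simpa [mul_assoc] using this

theorem mem_zpowers_or_mem_zpowers [Finite G] (hG : RelBasis G) {p q : ℕ} (hp : p.Prime)
    (hq : q.Prime) (hpq : p ≠ q) {V₀ : Subgroup G} (hV₀ : IsPGroup p V₀) (hne : V₀ ≠ ⊥) {a b : G}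
    (ha : IsPGroup q (zpowers a)) (haV : a ∈ normalizer V₀) (hbV : b ∈ normalizer V₀)
    (hba : b ∈ normalizer (zpowers a)) : a ∈ zpowers b ∨ b ∈ zpowers a := by
  by_contra! h
  have ha1 : a ≠ 1 := by rintro rfl; exact h.1 (one_mem _)
  have hab : b ≠ a := by rintro rfl; exact h.1 (mem_zpowers _)
  obtain ⟨V, hVV, hV1, hLV, hVc, hmin⟩ := exists_minimal_invariant (L := closure {a, b}) hp hV₀ hne
    ((closure_le _).2 (by rintro x (rfl | rfl); exacts [haV, hbV]))
  have haL : a ∈ closure {a, b} := subset_closure (by simp)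
  have hbL : b ∈ closure {a, b} := subset_closure (by simp)
  have hVp : IsPGroup p V := hV₀.to_le hVV
  have hcop : ∀ v ∈ V, Commute a v → v = 1 := fun v hv hc ↦
    (eq_one_of_commute hG hc
      (coprime_orderOf hq hp hpq.symm ha hVp (mem_zpowers a) hv)).resolve_left
      ha1
  have hLA : closure {a, b} ≤ normalizer (zpowers a) :=
    (closure_le _).2 (by rintro x (rfl | rfl); exacts [le_normalizer (mem_zpowers _), hba])
  have hdisj : ∀ y ∈ V, y ∈ zpowers a → y = 1 := by
    intro y hy hya
    rw [← orderOf_eq_one_iff]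
    exact Nat.eq_one_of_dvd_coprimes
      (coprime_orderOf hq hp hpq.symm ha hVp hya hy) dvd_rfl dvd_rfl
  have hbot : closure {a, b} ⊓ V = ⊥ := by
    rw [eq_bot_iff]
    rintro v ⟨hvL, hv⟩
    refine hcop v hv ?_
    have h1 : v * a * v⁻¹ * a⁻¹ ∈ zpowers a :=
      mul_mem ((mem_normalizer_iff.1 (hLA hvL) a).1 (mem_zpowers a)) (inv_mem (mem_zpowers a))
    have h2 : v * a * v⁻¹ * a⁻¹ ∈ V := by
      have := (mem_normalizer_iff.1 (hLV haL) v⁻¹).1 (inv_mem hv)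
      simpa [mul_assoc] using mul_mem hv this
    have h3 := hdisj _ h2 h1
    rw [mul_inv_eq_one, mul_inv_eq_iff_eq_mul] at h3
    exact h3.symm
  obtain ⟨v, hv, hv1⟩ := (bot_or_exists_ne_one V).resolve_left hV1
  have hZ := inf_eq_bot_of_irredundant hG hLV hbot hV1 hVc hmin (irredundant_pair h.1 h.2) rfl
    (x := b) (v := v) (by simp) hv
  set H := closure (insert (b * v) ({a, b} \ {b})) with hH
  have haH : a ∈ H := subset_closure (Or.inr ⟨by simp, hab.symm⟩)
  have hbv : b * v ∈ H := subset_closure (by simp)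
  apply hv1
  refine hcop v hv ?_
  have h1 : b * (v * a * v⁻¹ * a⁻¹) * b⁻¹ ∈ H ⊓ V := by
    constructor
    · have : b * a⁻¹ * b⁻¹ ∈ H := (zpowers_le.2 haH)
        ((mem_normalizer_iff.1 hba a⁻¹).1 (inv_mem (mem_zpowers a)))
      have h2 := mul_mem (mul_mem (mul_mem hbv haH) (inv_mem hbv)) this
      have h3 : b * (v * a * v⁻¹ * a⁻¹) * b⁻¹ = b * v * a * (b * v)⁻¹ * (b * a⁻¹ * b⁻¹) := by
        group
      exact h3 ▸ h2
    · refine (mem_normalizer_iff.1 (hLV hbL) _).1 ?_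
      have := (mem_normalizer_iff.1 (hLV haL) v⁻¹).1 (inv_mem hv)
      simpa [mul_assoc] using mul_mem hv this
  rw [hZ, mem_bot, conj_eq_one_iff, mul_inv_eq_one, mul_inv_eq_iff_eq_mul] at h1
  exact h1.symm

theorem isCyclic_of_normalizes [Finite G] (hG : RelBasis G) {p q : ℕ} (hp : p.Prime)
    (hq : q.Prime) (hpq : p ≠ q) {V₀ Q : Subgroup G} (hV₀ : IsPGroup p V₀) (hne : V₀ ≠ ⊥)
    (hQ : IsPGroup q Q) (hQV : Q ≤ normalizer V₀) : IsCyclic Q := by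
  have := Fact.mk hq
  obtain ⟨A, -, hA⟩ := exists_maximal_ge_of_wellFoundedGT
    (fun A : Subgroup Q ↦ ∃ a, zpowers a = A) ⊥ ⟨1, zpowers_one_eq_bot⟩
  obtain ⟨a, rfl⟩ := hA.prop
  rw [isCyclic_iff_exists_zpowers_eq_top]
  refine ⟨a, ?_⟩
  by_contra hlt
  have hnil : Group.IsNilpotent Q := hQ.isNilpotent
  obtain ⟨b, hb, hba⟩ := SetLike.exists_of_lt
    (Group.normalizerCondition_of_isNilpotent (zpowers a) (lt_top_iff_ne_top.2 hlt))
  have hQ' : RelBasis Q := hG.subgroup Q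
  have hmap : ((b : Q) : G) ∈ normalizer (zpowers (a : G) : Set G) := by
    have := le_normalizer_map Q.subtype (mem_map_of_mem Q.subtype hb)
    rwa [MonoidHom.map_zpowers] at this
  have hval : ∀ x y : Q, (x : G) ∈ zpowers (y : G) → x ∈ zpowers y := by
    rintro x y ⟨k, hk⟩
    exact ⟨k, Subtype.ext hk⟩
  rcases mem_zpowers_or_mem_zpowers hG hp hq hpq hV₀ hne
    (hQ.to_le (zpowers_le.2 a.2)) (hQV a.2) (hQV b.2) hmap with h | h
  · have h1 : zpowers a ≤ zpowers b := zpowers_le.2 (hval _ _ h)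
    exact hba (hA.le_of_ge ⟨b, rfl⟩ h1 (mem_zpowers b))
  · exact hba (hval _ _ h)

end Action

section Frobenius

variable {G : Type*} [Group G]

theorem map_eq_one_of_coprime {H : Type*} [Group H] (f : G →* H) {x : G}
    (h : (orderOf x).Coprime (Nat.card H)) : f x = 1 :=
  orderOf_eq_one_iff.1 (Nat.eq_one_of_dvd_coprimes h (orderOf_map_dvd f x) (orderOf_dvd_natCard _))

theorem mem_of_coprime_index {P : Subgroup G} [P.Normal] {x : G}
    (h : (orderOf x).Coprime P.index) : x ∈ P :=
  (QuotientGroup.eq_one_iff x).1 (map_eq_one_of_coprime (QuotientGroup.mk' P) h)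

theorem normalizer_le_centralizer_of_normal [Finite G] (hG : RelBasis G) {p q : ℕ} (hp : p.Prime)
    (hq : q.Prime) (hpq : p ≠ q) {N Q : Subgroup G} [N.Normal] (hN : IsPGroup p N) (hne : N ≠ ⊥)
    (hQ : IsPGroup q Q) : IsCyclic Q ∧ normalizer (Q : Set G) ≤ centralizer Q := by
  have hle : ∀ g : G, g ∈ normalizer (N : Set G) := fun g ↦ normalizer_eq_top N ▸ mem_top g
  have hcyc := isCyclic_of_normalizes hG hp hq hpq hN hne hQ fun g _ ↦ hle g
  refine ⟨hcyc, fun b hb ↦ ?_⟩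
  obtain ⟨a, rfl⟩ := (Subgroup.isCyclic_iff_exists_zpowers_eq_top Q).1 hcyc
  have hab : Commute a b := by
    rcases mem_zpowers_or_mem_zpowers hG hp hq hpq hN hne hQ (hle a) (hle b) hb with
      ⟨k, hk⟩ | ⟨k, hk⟩
    · rw [← hk]
      exact (Commute.refl b).zpow_left k
    · rw [← hk]
      exact (Commute.refl a).zpow_right k
  rw [mem_centralizer_iff]
  rintro _ ⟨k, rfl⟩
  exact hab.zpow_left k

theorem exists_frobenius [Finite G] (hG : RelBasis G) {p : ℕ} (hp : p.Prime)
    {N : Subgroup G} [N.Normal] (hN : IsPGroup p N) (hne : N ≠ ⊥) :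
    ∃ P : Subgroup G, P.Normal ∧ IsPGroup p P ∧ ¬ p ∣ P.index ∧ (P = ⊤ ∨
      ∃ q : ℕ, q.Prime ∧ p ≠ q ∧ ∃ Q : Subgroup G, Q ≠ ⊥ ∧ IsCyclic Q ∧ IsPGroup q Q ∧
        ¬ q ∣ Q.index ∧ IsComplement' P Q) := by
  have := Fact.mk hp
  by_cases hex : ∃ q : ℕ, q.Prime ∧ q ≠ p ∧ q ∣ Nat.card G
  swap
  · push Not at hex
    refine ⟨⊤, inferInstance, ?_, by simpa using hp.ne_one, Or.inl rfl⟩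
    refine IsPGroup.of_card (n := (Nat.card G).primeFactorsList.length) ?_
    rw [Nat.card_congr topEquiv.toEquiv]
    refine Nat.eq_prime_pow_of_unique_prime_dvd Nat.card_pos.ne' fun hd hd' ↦ ?_
    by_contra h
    exact hex _ hd h hd'
  obtain ⟨q, hq, hqp, hqG⟩ := hex
  have key : ∀ q : ℕ, q.Prime → q ≠ p → q ∣ Nat.card G → ∃ Q : Subgroup G, ∃ f : G →* Q,
      Q ≠ ⊥ ∧ IsCyclic Q ∧ IsPGroup q Q ∧ ¬ q ∣ Q.index ∧ IsComplement' f.ker Q := by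
    intro q hq hqp hqG
    have := Fact.mk hq
    obtain ⟨Q⟩ : Nonempty (Sylow q G) := inferInstance
    obtain ⟨hcyc, hNC⟩ := normalizer_le_centralizer_of_normal hG hp hq hqp.symm hN hne Q.isPGroup'
    exact ⟨Q, MonoidHom.transferSylow Q hNC, Q.ne_bot_of_dvd_card hqG, hcyc, Q.isPGroup',
      Q.not_dvd_index, MonoidHom.ker_transferSylow_isComplement' Q hNC⟩
  obtain ⟨Q, f, hQ1, hQc, hQp, hQi, hfQ⟩ := key q hq hqp hqG
  have hcard : ∀ {q : ℕ}, q.Prime → ∀ {Q : Subgroup G}, IsPGroup q Q → ∃ k, Nat.card Q = q ^ k := by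
    intro q hq Q hQ
    have := Fact.mk hq
    exact IsPGroup.iff_card.1 hQ
  have hKp : IsPGroup p f.ker := by
    refine IsPGroup.of_card (n := (Nat.card f.ker).primeFactorsList.length) ?_
    refine Nat.eq_prime_pow_of_unique_prime_dvd Nat.card_pos.ne' fun {s} hs hsK ↦ ?_
    by_contra hsp
    have hsq : s ≠ q := by
      rintro rfl
      rw [← hfQ.index_eq_card] at hsK
      exact hQi hsK
    obtain ⟨S, g, hS1, -, hSp, -, hgS⟩ := key s hs hsp (hsK.trans (card_subgroup_dvd_card _))
    obtain ⟨x, hx, hx1⟩ := (bot_or_exists_ne_one Q).resolve_left hQ1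
    obtain ⟨y, hy, hy1⟩ := (bot_or_exists_ne_one S).resolve_left hS1
    obtain ⟨k, hk⟩ := hcard hq hQp
    obtain ⟨l, hl⟩ := hcard hs hSp
    have hc : (Nat.card Q).Coprime (Nat.card S) := by
      rw [hk, hl]; exact Nat.coprime_pow_primes _ _ hq hs hsq.symm
    have hxo : orderOf x ∣ Nat.card Q := by
      rw [← orderOf_mk x hx]; exact orderOf_dvd_natCard _
    have hyo : orderOf y ∣ Nat.card S := by
      rw [← orderOf_mk y hy]; exact orderOf_dvd_natCard _
    have hfy : f y = 1 := map_eq_one_of_coprime f (hc.symm.coprime_dvd_left hyo)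
    have hgx : g x = 1 := map_eq_one_of_coprime g (hc.coprime_dvd_left hxo)
    have hfx : f x ≠ 1 := fun h ↦ hx1 (by
      have : x ∈ f.ker ⊓ Q := ⟨h, hx⟩
      rwa [hfQ.disjoint.eq_bot, mem_bot] at this)
    have hgy : g y ≠ 1 := fun h ↦ hy1 (by
      have : y ∈ g.ker ⊓ S := ⟨h, hy⟩
      rwa [hgS.disjoint.eq_bot, mem_bot] at this)
    have hdvd : ∀ {r : ℕ} {R : Subgroup G} (z : R), r.Prime → IsPGroup r R → z ≠ 1 →
        r ∣ orderOf z := by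
      intro r R z hr hR hz
      have := Fact.mk hr
      obtain ⟨n, hn⟩ := IsPGroup.iff_orderOf.1 hR z
      rw [hn]
      refine dvd_pow_self r fun h0 ↦ hz ?_
      rwa [h0, pow_zero, orderOf_eq_one_iff] at hn
    have h1 : q ∣ orderOf (x * y) :=
      (hdvd (f (x * y)) hq hQp (by rwa [map_mul, hfy, mul_one])).trans
      (orderOf_map_dvd f _)
    have h2 : s ∣ orderOf (x * y) :=
      (hdvd (g (x * y)) hs hSp (by rwa [map_mul, hgx, one_mul])).trans
      (orderOf_map_dvd g _)
    obtain ⟨n, hn⟩ := orderOf_eq_pow hG hq h1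
    rw [hn] at h2
    exact hsq ((Nat.prime_dvd_prime_iff_eq hs hq).1 (hs.dvd_of_dvd_pow h2))
  refine ⟨f.ker, inferInstance, hKp, ?_, Or.inr ⟨q, hq, hqp.symm, Q, hQ1, hQc, hQp, hQi, hfQ⟩⟩
  obtain ⟨k, hk⟩ := hcard hq hQp
  rw [hfQ.symm.index_eq_card, hk]
  exact fun h ↦ hqp ((Nat.prime_dvd_prime_iff_eq hp hq).1 (hp.dvd_of_dvd_pow h)).symm

theorem exists_normal_maximal_pSubgroup [Finite G] (hG : RelBasis G) {p : ℕ} (hp : p.Prime)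
    {N H : Subgroup G} (hN : IsPGroup p N) (hne : N ≠ ⊥) (hNH : N ≤ H)
    (hHN : H ≤ normalizer N) :
    ∃ T ≤ H, H ≤ normalizer T ∧ IsPGroup p T ∧ (∀ R ≤ H, IsPGroup p R → R ≤ T) ∧
      ∃ q k : ℕ, q.Prime ∧ p ≠ q ∧ Nat.card H = Nat.card T * q ^ k := by
  have := Fact.mk hp
  have hnorm : (N.subgroupOf H).Normal := (normal_subgroupOf_iff_le_normalizer hNH).2 hHN
  obtain ⟨P, hPn, hPp, hPi, hP⟩ := exists_frobenius (hG.subgroup H) hp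
    (N := N.subgroupOf H) (hN.comap_subtype) (by
      rw [Ne, subgroupOf_eq_bot, disjoint_iff, inf_eq_left.2 hNH]; exact hne)
  have hPH : (P.map H.subtype).subgroupOf H = P :=
    comap_map_eq_self_of_injective H.subtype_injective P
  have hTH : P.map H.subtype ≤ H := map_subtype_le P
  have hcop : ∀ x : H, (∃ k, orderOf x = p ^ k) → x ∈ P := by
    rintro x ⟨k, hk⟩
    refine mem_of_coprime_index ?_
    rw [hk]
    exact Nat.Coprime.pow_left _ (hp.coprime_iff_not_dvd.2 hPi)
  refine ⟨P.map H.subtype, hTH, ?_, hPp.map _, ?_, ?_⟩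
  · rw [← normal_subgroupOf_iff_le_normalizer hTH, hPH]
    exact hPn
  · intro R hRH hR x hx
    refine ⟨⟨x, hRH hx⟩, hcop _ ?_, rfl⟩
    obtain ⟨k, hk⟩ := IsPGroup.iff_orderOf.1 hR ⟨x, hx⟩
    exact ⟨k, by rwa [orderOf_mk] at hk ⊢⟩
  · have hc : Nat.card (P.map H.subtype) = Nat.card P :=
      card_map_of_injective H.subtype_injective
    rw [hc]
    rcases hP with rfl | ⟨q, hq, hpq, Q, -, -, hQ, -, hPQ⟩
    · obtain ⟨q, hq, hq'⟩ := Nat.exists_infinite_primes (p + 1)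
      exact ⟨q, 0, hq', by omega, by rw [pow_zero, mul_one, card_top]⟩
    · have := Fact.mk hq
      obtain ⟨k, hk⟩ := IsPGroup.iff_card.1 hQ
      exact ⟨q, k, hq, hpq, by rw [← hk, hPQ.card_mul_card]⟩

end Frobenius

open scoped commutatorElement

/-- A finite nontrivial group with the relative basis property without nontrivial normal
subgroups of prime power order, all of whose nontrivial proper subgroups do have one. -/
structure MinimalCounterexample (G : Type*) [Group G] : Prop where
  basis : RelBasis G
  nontrivial : Nontrivial G
  eq_bot : ∀ (p : ℕ) (N : Subgroup G), p.Prime → N.Normal → IsPGroup p N → N = ⊥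
  exists_local : ∀ H : Subgroup G, H ≠ ⊤ → H ≠ ⊥ → ∃ (p : ℕ) (N : Subgroup G),
    p.Prime ∧ IsPGroup p N ∧ N ≠ ⊥ ∧ N ≤ H ∧ H ≤ normalizer N

namespace MinimalCounterexample

section

variable {G : Type*} [Group G]

theorem normalizer_ne_top (hG : MinimalCounterexample G) {p : ℕ} (hp : p.Prime) {N : Subgroup G}
    (hN : IsPGroup p N) (hne : N ≠ ⊥) : normalizer (N : Set G) ≠ ⊤ :=
  fun h ↦ hne (hG.eq_bot p N hp (normalizer_eq_top_iff.1 h) hN)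

theorem exists_mem_normalizer_of_lt [Finite G] {p : ℕ} [Fact p.Prime] {D P : Subgroup G}
    (hP : IsPGroup p P)
    (h : D < P) : ∃ x ∈ P, x ∈ normalizer (D : Set G) ∧ x ∉ D := by
  have hnil : Group.IsNilpotent P := hP.isNilpotent
  obtain ⟨x, hx, hxD⟩ := SetLike.exists_of_lt
    (Group.normalizerCondition_of_isNilpotent (D.subgroupOf P) (lt_top_iff_ne_top.2 fun h' ↦
      h.not_ge (subgroupOf_eq_top.1 h')))
  rw [← subgroupOf_normalizer_eq h.le] at hx
  exact ⟨x, x.2, hx, hxD⟩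

theorem mem_sylow_of_mem_normalizer {p : ℕ} (P : Sylow p G) {x : G}
    (hx : x ∈ normalizer (P : Set G)) (hxp : IsPGroup p (zpowers x)) : x ∈ P := by
  have h1 : IsPGroup p (zpowers x ⊔ P : Subgroup G) :=
    hxp.to_sup_of_normal_right' P.isPGroup' (zpowers_le.2 hx)
  have h2 := P.is_maximal' h1 le_sup_right
  have : x ∈ (zpowers x ⊔ P : Subgroup G) := mem_sup_left (mem_zpowers x)
  rw [h2] at this
  exact this

theorem isPGroup_zpowers {p k : ℕ} {x : G} (h : orderOf x = p ^ k) : IsPGroup p (zpowers x) :=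
  IsPGroup.of_card (n := k) (by rw [Nat.card_zpowers, h])

variable [Finite G]

theorem exists_normal_maximal (hG : MinimalCounterexample G) {H : Subgroup G} (hH : H ≠ ⊤)
    (hH' : H ≠ ⊥) : ∃ r : ℕ, r.Prime ∧ ∃ T ≤ H, T ≠ ⊥ ∧ H ≤ normalizer T ∧ IsPGroup r T ∧
      (∀ R ≤ H, IsPGroup r R → R ≤ T) ∧
      ∃ q k : ℕ, q.Prime ∧ r ≠ q ∧ Nat.card H = Nat.card T * q ^ k := by
  obtain ⟨r, N, hr, hN, hne, hNH, hHN⟩ := hG.exists_local H hH hH'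
  obtain ⟨T, hTH, hHT, hT, hmax, h⟩ := exists_normal_maximal_pSubgroup hG.basis hr hN hne hNH hHN
  exact ⟨r, hr, T, hTH, fun h ↦ hne (le_bot_iff.1 (h ▸ hmax N hNH hN)), hHT, hT, hmax, h⟩

theorem sylow_eq_of_inf_ne_bot (hG : MinimalCounterexample G) {p : ℕ} [Fact p.Prime]
    (P P' : Sylow p G) (h : (P : Subgroup G) ⊓ P' ≠ ⊥) : P = P' := by
  by_contra hne
  let bad : Set (Sylow p G × Sylow p G) :=
    {x | (x.1 : Subgroup G) ⊓ x.2 ≠ ⊥ ∧ x.1 ≠ x.2}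
  have : Nonempty bad := ⟨⟨(P, P'), h, hne⟩⟩
  obtain ⟨⟨⟨A, B⟩, hAB, hABne⟩, hmax⟩ :=
    Finite.exists_max fun x : bad ↦ Nat.card ((x.1.1 : Subgroup G) ⊓ x.1.2 : Subgroup G)
  dsimp only at hAB hABne
  set D : Subgroup G := (A : Subgroup G) ⊓ B with hD
  have hDp : IsPGroup p D := A.isPGroup'.to_le inf_le_left
  obtain ⟨T, hTH, hHT, hT, hTmax, -⟩ := exists_normal_maximal_pSubgroup hG.basis Fact.out hDp hAB
    le_normalizer le_rfl
  obtain ⟨C, hC⟩ := hT.exists_le_sylow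
  have key : ∀ E : Sylow p G, D ≤ E → D ≠ E → E = C := by
    intro E hDE hne
    obtain ⟨x, hxE, hxN, hxD⟩ := exists_mem_normalizer_of_lt E.isPGroup' (lt_of_le_of_ne hDE hne)
    have h1 : (E : Subgroup G) ⊓ normalizer D ≤ T :=
      hTmax _ inf_le_right (E.isPGroup'.to_le inf_le_left)
    have h2 : D < (E : Subgroup G) ⊓ C := by
      refine lt_of_le_of_ne (le_inf hDE ((le_inf hDE le_normalizer).trans (h1.trans hC))) ?_
      intro h
      rw [h] at hxD
      exact hxD ⟨hxE, hC (h1 ⟨hxE, hxN⟩)⟩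
    by_contra hEC
    have h3 := hmax ⟨(E, C), fun h ↦ (h ▸ h2).not_ge bot_le, hEC⟩
    have h4 : Nat.card D < Nat.card ((E : Subgroup G) ⊓ C : Subgroup G) :=
      Set.ncard_lt_ncard h2 (Set.toFinite _)
    exact h4.not_ge h3
  have hAC := key A inf_le_left fun h ↦ hABne (by
    have : (A : Subgroup G) ≤ B := h ▸ inf_le_right
    exact (Sylow.ext (A.is_maximal' B.isPGroup' this)).symm)
  have hBC := key B inf_le_right fun h ↦ hABne (by
    have : (B : Subgroup G) ≤ A := h ▸ inf_le_left
    exact (Sylow.ext (B.is_maximal' A.isPGroup' this)))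
  exact hABne (hAC.trans hBC.symm)

theorem mem_normalizer_of_conj_mem (hG : MinimalCounterexample G) {p : ℕ} [Fact p.Prime]
    (P : Sylow p G) {g x : G} (hx : x ∈ P) (hx1 : x ≠ 1) (hg : g * x * g⁻¹ ∈ P) :
    g ∈ normalizer (P : Set G) := by
  refine Sylow.smul_eq_iff_mem_normalizer.1 (hG.sylow_eq_of_inf_ne_bot _ _ fun h ↦ hx1 ?_)
  have : g * x * g⁻¹ ∈ ((g • P : Sylow p G) : Subgroup G) ⊓ P := by
    refine ⟨?_, hg⟩
    rw [Sylow.coe_subgroup_smul]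
    exact ⟨x, hx, rfl⟩
  rwa [h, mem_bot, conj_eq_one_iff] at this

theorem le_sylow_of_mem (hG : MinimalCounterexample G) {p : ℕ} [Fact p.Prime]
    (P : Sylow p G) {T : Subgroup G} (hT : IsPGroup p T) {x : G} (hx : x ∈ P) (hxT : x ∈ T)
    (hx1 : x ≠ 1) : T ≤ P := by
  obtain ⟨C, hC⟩ := hT.exists_le_sylow
  rw [hG.sylow_eq_of_inf_ne_bot P C]
  · exact hC
  · intro h
    have : x ∈ (P : Subgroup G) ⊓ C := ⟨hx, hC hxT⟩
    rw [h, mem_bot] at this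
    exact hx1 this

theorem normalizer_le_normalizer_sylow (hG : MinimalCounterexample G) {p : ℕ} [Fact p.Prime]
    (P : Sylow p G) {T : Subgroup G} (hT : IsPGroup p T) {x : G} (hx : x ∈ P) (hxT : x ∈ T)
    (hx1 : x ≠ 1) : normalizer (T : Set G) ≤ normalizer (P : Set G) := fun _ hg ↦
  hG.mem_normalizer_of_conj_mem P hx hx1
    (hG.le_sylow_of_mem P hT hx hxT hx1 ((mem_normalizer_iff.1 hg x).1 hxT))

theorem eq_top_of_normal (hG : MinimalCounterexample G) {K : Subgroup G} (hK : K.Normal)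
    (hne : K ≠ ⊥) : K = ⊤ := by
  by_contra htop
  obtain ⟨r, hr, T, hTK, hT1, -, hT, hmax, -⟩ := hG.exists_normal_maximal htop hne
  refine hT1 (hG.eq_bot r T hr ⟨fun x hx g ↦ ?_⟩ hT)
  have h1 : T.map (MulAut.conj g).toMonoidHom ≤ K := by
    rintro _ ⟨y, hy, rfl⟩
    exact hK.conj_mem y (hTK hy) g
  exact hmax _ h1 (hT.map _) ⟨x, hx, rfl⟩

theorem sylow_ne_bot {p : ℕ} [Fact p.Prime] (hpG : p ∣ Nat.card G) (P : Sylow p G) :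
    (P : Subgroup G) ≠ ⊥ := P.ne_bot_of_dvd_card hpG

theorem exists_not_commute (hG : MinimalCounterexample G) : ∃ x y : G, ¬ Commute x y := by
  by_contra! h
  have := hG.nontrivial
  obtain ⟨p, hp, hpG⟩ := Nat.exists_prime_and_dvd (Finite.one_lt_card (α := G)).ne'
  have := Fact.mk hp
  obtain ⟨P⟩ : Nonempty (Sylow p G) := inferInstance
  refine sylow_ne_bot hpG P (hG.eq_bot p P hp ⟨fun x hx g ↦ ?_⟩ P.isPGroup')
  rwa [(h g x).eq, mul_inv_cancel_right]

theorem normalizer_sylow_ne (hG : MinimalCounterexample G) {p : ℕ} [Fact p.Prime]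
    (hpG : p ∣ Nat.card G) (P : Sylow p G) : ¬ normalizer (P : Set G) ≤ P := by
  intro hN
  have hcomm : _root_.commutator G = ⊤ := by
    refine hG.eq_top_of_normal inferInstance fun h ↦ ?_
    obtain ⟨x, y, hxy⟩ := hG.exists_not_commute
    apply hxy
    have : ⁅x, y⁆ ∈ _root_.commutator G := commutator_mem_commutator (mem_top x) (mem_top y)
    rw [h, mem_bot, commutatorElement_eq_one_iff_commute] at this
    exact this
  have hfoc := commutator_inf_eq_focalSubgroup P
  rw [hcomm, top_inf_eq] at hfoc
  have h1 : (P : Subgroup G) ≤ ⁅(P : Subgroup G), (P : Subgroup G)⁆ := by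
    conv_lhs => rw [hfoc, focalSubgroup_def]
    refine (closure_le _).2 ?_
    rintro _ ⟨hg, x, hx, u, rfl⟩
    by_cases hx1 : x = 1
    · simp [hx1]
    have hu : u * x⁻¹ * u⁻¹ ∈ P := by
      have := mul_mem (inv_mem hx) hg
      rwa [commutatorElement_def, ← mul_assoc, ← mul_assoc, ← mul_assoc, inv_mul_cancel,
        one_mul] at this
    have huP : u ∈ P := hN (hG.mem_normalizer_of_conj_mem P (inv_mem hx) (by simpa using hx1) hu)
    exact commutator_mem_commutator hx huP
  have hnt : Nontrivial P := (nontrivial_iff_ne_bot _).2 (sylow_ne_bot hpG P)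
  have hnil : Group.IsNilpotent P := P.isPGroup'.isNilpotent
  have h2 := Group.IsSolvable.commutator_lt_top_of_nontrivial P
  apply h2.ne
  rw [← map_subtype_commutator] at h1
  rw [eq_top_iff]
  intro x _
  obtain ⟨y, hy, hyx⟩ := h1 x.2
  rwa [← Subtype.ext hyx]

theorem card_normalizer_sylow (hG : MinimalCounterexample G) {p : ℕ} [Fact p.Prime]
    (hpG : p ∣ Nat.card G) (P : Sylow p G) : ∃ q k : ℕ, q.Prime ∧ p ≠ q ∧
      Nat.card (normalizer (P : Set G)) = Nat.card P * q ^ k := by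
  obtain ⟨T, -, -, hT, hTmax, q, k, hq, hpq, h⟩ := exists_normal_maximal_pSubgroup hG.basis
    Fact.out P.isPGroup' (sylow_ne_bot hpG P) le_normalizer le_rfl
  have : T = P := P.is_maximal' hT (hTmax _ le_normalizer P.isPGroup')
  exact ⟨q, k, hq, hpq, this ▸ h⟩

theorem eq_one_of_commute_normalizer (hG : MinimalCounterexample G) {p : ℕ} [Fact p.Prime]
    (P : Sylow p G) {g x : G} (hg : g ∈ normalizer (P : Set G)) (hgP : g ∉ P) (hx : x ∈ P)
    (h : Commute g x) : x = 1 := by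
  by_contra hx1
  have hpg : ¬ p ∣ orderOf g := fun hd ↦ by
    obtain ⟨k, hk⟩ := orderOf_eq_pow hG.basis Fact.out hd
    exact hgP (mem_sylow_of_mem_normalizer P hg (isPGroup_zpowers hk))
  obtain ⟨k, hk⟩ := IsPGroup.iff_orderOf.1 P.isPGroup' ⟨x, hx⟩
  rw [orderOf_mk] at hk
  refine hx1 ((eq_one_of_commute hG.basis h ?_).resolve_left ?_)
  · rw [hk]
    exact Nat.Coprime.pow_right _ (Nat.Coprime.symm
      ((Nat.Prime.coprime_iff_not_dvd Fact.out).2 hpg))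
  · rintro rfl
    exact hgP (one_mem _)

end

end MinimalCounterexample

namespace MinimalCounterexample

section

variable {G : Type*} [Group G]

/-- A chosen Sylow subgroup. -/
noncomputable def sylowOf (G : Type*) [Group G] (p : ℕ) : Sylow p G :=
  Classical.choice inferInstance

/-- The index of a chosen Sylow subgroup in its normalizer, see `card_normalizer_sylowOf`. -/
noncomputable def sylowIndex (G : Type*) [Group G] (p : ℕ) : ℕ :=
  (sylowOf G p : Subgroup G).relIndex (normalizer (sylowOf G p : Set G))

theorem card_normalizer_sylowOf (p : ℕ) : Nat.card (normalizer (sylowOf G p : Set G)) =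
    Nat.card (sylowOf G p) * sylowIndex G p := by
  have h := index_mul_card
    ((sylowOf G p : Subgroup G).subgroupOf (normalizer (sylowOf G p : Set G)))
  have e := Nat.card_congr (subgroupOfEquivOfLe
    (le_normalizer (H := (sylowOf G p : Subgroup G)))).toEquiv
  exact h.symm.trans ((mul_comm _ _).trans (congrArg (· * sylowIndex G p) e))

variable [Finite G]

theorem sylowIndex_eq_pow (hG : MinimalCounterexample G) {p : ℕ} (hp : p.Prime)
    (hpG : p ∣ Nat.card G) : ∃ q k : ℕ, q.Prime ∧ p ≠ q ∧ sylowIndex G p = q ^ k := by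
  have := Fact.mk hp
  obtain ⟨q, k, hq, hpq, h⟩ := hG.card_normalizer_sylow hpG (sylowOf G p)
  rw [card_normalizer_sylowOf] at h
  exact ⟨q, k, hq, hpq, Nat.eq_of_mul_eq_mul_left Nat.card_pos h⟩

theorem two_le_sylowIndex (hG : MinimalCounterexample G) {p : ℕ} (hp : p.Prime)
    (hpG : p ∣ Nat.card G) : 2 ≤ sylowIndex G p := by
  have := Fact.mk hp
  have h1 : sylowIndex G p ≠ 1 := fun h ↦
    hG.normalizer_sylow_ne hpG (sylowOf G p) (relIndex_eq_one.1 h)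
  have h2 : sylowIndex G p ≠ 0 := fun h ↦ by
    have h3 := card_normalizer_sylowOf (G := G) p
    rw [h, mul_zero] at h3
    exact Nat.card_pos.ne' h3
  omega

theorem ncard_pElements_le (p : ℕ) [Fact p.Prime] (P : Sylow p G) :
    {x : G | x ≠ 1 ∧ ∃ Q : Sylow p G, x ∈ Q}.ncard ≤
      Nat.card (Sylow p G) * (Nat.card P - 1) := by
  classical
  have := Fintype.ofFinite G
  have := Fintype.ofFinite (Sylow p G)
  have h1 : {x : G | x ≠ 1 ∧ ∃ Q : Sylow p G, x ∈ Q} = ((Finset.univ : Finset (Sylow p G)).biUnion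
      fun Q ↦ (Finset.univ.filter fun x ↦ x ∈ Q).erase 1 : Finset G) := by
    ext x
    simp [and_comm]
  rw [h1, Set.ncard_coe_finset, Nat.card_eq_fintype_card]
  refine Finset.card_biUnion_le_card_mul _ _ _ fun Q _ ↦ ?_
  rw [Finset.card_erase_of_mem (by simp), ← Nat.card_congr (Sylow.equiv Q P).toEquiv]
  refine Nat.sub_le_sub_right (le_of_eq ?_) 1
  rw [Nat.card_eq_fintype_card, Fintype.card_subtype]
  rfl

theorem one_lt_sum_inv_sylowIndex (hG : MinimalCounterexample G) :
    1 < ∑ p ∈ (Nat.card G).primeFactors, ((sylowIndex G p : ℚ))⁻¹ := by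
  classical
  set S := (Nat.card G).primeFactors with hS
  have hN : 0 < Nat.card G := Nat.card_pos
  have hSp : ∀ p ∈ S, p.Prime := fun p hp ↦ Nat.prime_of_mem_primeFactors hp
  have hSd : ∀ p ∈ S, p ∣ Nat.card G := fun p hp ↦ Nat.dvd_of_mem_primeFactors hp
  have hsyl : ∀ p ∈ S, Nat.card (Sylow p G) * (Nat.card (sylowOf G p) * sylowIndex G p) =
      Nat.card G := by
    intro p hp
    have := Fact.mk (hSp p hp)
    rw [Sylow.card_eq_index_normalizer (sylowOf G p), ← card_normalizer_sylowOf, index_mul_card]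
  have hle : Nat.card G - 1 ≤ ∑ p ∈ S, Nat.card (Sylow p G) * (Nat.card (sylowOf G p) - 1) := by
    have h1 : ({1}ᶜ : Set G) ⊆ ⋃ p ∈ S, {x : G | x ≠ 1 ∧ ∃ Q : Sylow p G, x ∈ Q} := by
      intro x hx
      have hx1 : x ≠ 1 := hx
      obtain ⟨p, hp, hpx⟩ := Nat.exists_prime_and_dvd (mt orderOf_eq_one_iff.1 hx1)
      obtain ⟨k, hk⟩ := orderOf_eq_pow hG.basis hp hpx
      have := Fact.mk hp
      obtain ⟨Q, hQ⟩ := (isPGroup_zpowers hk).exists_le_sylow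
      simp only [Set.mem_iUnion]
      exact ⟨p, Nat.mem_primeFactors.2 ⟨hp, hpx.trans (orderOf_dvd_natCard x), hN.ne'⟩, hx1, Q,
        hQ (mem_zpowers x)⟩
    have h2 := Set.ncard_le_ncard h1 (Set.toFinite _)
    rw [Set.ncard_compl, Set.ncard_singleton] at h2
    refine h2.trans ((Finset.set_ncard_biUnion_le _ _).trans (Finset.sum_le_sum fun p hp ↦ ?_))
    have := Fact.mk (hSp p hp)
    exact ncard_pElements_le p _
  have hsum : Nat.card G + 1 ≤ ∑ p ∈ S, Nat.card (Sylow p G) * Nat.card (sylowOf G p) := by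
    have h3 : ∑ p ∈ S, Nat.card (Sylow p G) * Nat.card (sylowOf G p) =
        ∑ p ∈ S, Nat.card (Sylow p G) * (Nat.card (sylowOf G p) - 1) +
          ∑ p ∈ S, Nat.card (Sylow p G) := by
      rw [← Finset.sum_add_distrib]
      refine Finset.sum_congr rfl fun p _ ↦ ?_
      have : 0 < Nat.card (sylowOf G p) := Nat.card_pos
      obtain ⟨a, ha⟩ : ∃ a, Nat.card (sylowOf G p) = a + 1 := ⟨_, (Nat.sub_add_cancel this).symm⟩
      rw [ha]
      simp [mul_add]
    have := hG.nontrivial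
    obtain ⟨p, hp, hpG⟩ := Nat.exists_prime_and_dvd (Finite.one_lt_card (α := G)).ne'
    have := Fact.mk hp
    have h4 : Nat.card (Sylow p G) ≤ ∑ p ∈ S, Nat.card (Sylow p G) :=
      Finset.single_le_sum (f := fun p ↦ Nat.card (Sylow p G)) (fun _ _ ↦ Nat.zero_le _)
        (Nat.mem_primeFactors.2 ⟨hp, hpG, hN.ne'⟩)
    have h5 : Nat.card (Sylow p G) ≠ 1 := by
      rw [Sylow.card_eq_index_normalizer (sylowOf G p), Ne, index_eq_one]
      exact hG.normalizer_ne_top hp (sylowOf G p).isPGroup' (sylow_ne_bot hpG _)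
    have h6 : 0 < Nat.card (Sylow p G) := Nat.card_pos
    omega
  have hN' : (0 : ℚ) < Nat.card G := by exact_mod_cast hN
  have h7 : ∑ p ∈ S, ((sylowIndex G p : ℚ))⁻¹ =
      (∑ p ∈ S, Nat.card (Sylow p G) * Nat.card (sylowOf G p) : ℕ) / (Nat.card G : ℚ) := by
    rw [Nat.cast_sum, Finset.sum_div]
    refine Finset.sum_congr rfl fun p hp ↦ ?_
    rw [← hsyl p hp] at hN ⊢
    have h8 : Nat.card (Sylow p G) ≠ 0 := by rintro h; simp [h] at hN
    have h9 : Nat.card (sylowOf G p) ≠ 0 := by rintro h; simp [h] at hN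
    have h10 : sylowIndex G p ≠ 0 := by rintro h; simp [h] at hN
    push_cast
    field_simp
  rw [h7, lt_div_iff₀ hN', one_mul]
  exact_mod_cast hsum

theorem two_lt_card_primeFactors (hG : MinimalCounterexample G) :
    2 < (Nat.card G).primeFactors.card := by
  have h1 := hG.one_lt_sum_inv_sylowIndex
  have h2 : ∑ p ∈ (Nat.card G).primeFactors, ((sylowIndex G p : ℚ))⁻¹ ≤
      (Nat.card G).primeFactors.card • (2 : ℚ)⁻¹ := by
    refine Finset.sum_le_card_nsmul _ _ _ fun p hp ↦ inv_anti₀ two_pos ?_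
    exact_mod_cast hG.two_le_sylowIndex (Nat.prime_of_mem_primeFactors hp)
      (Nat.dvd_of_mem_primeFactors hp)
  have h3 := h1.trans_le h2
  rw [nsmul_eq_mul] at h3
  have h4 : (2 : ℚ) < (Nat.card G).primeFactors.card := by linarith
  exact_mod_cast h4

theorem exists_closure_pair_eq_top (hG : MinimalCounterexample G) :
    ∃ x y : G, closure {x, y} = ⊤ := by
  classical
  have := hG.nontrivial
  obtain ⟨q, hq, hqG⟩ := Nat.exists_prime_and_dvd (Finite.one_lt_card (α := G)).ne'
  have := Fact.mk hq
  obtain ⟨s, k, hs, hqs, hsk⟩ := hG.sylowIndex_eq_pow hq hqG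
  obtain ⟨p, hp, hpqs⟩ : ∃ p ∈ (Nat.card G).primeFactors, p ∉ ({q, s} : Finset ℕ) := by
    by_contra! h
    have h1 := Finset.card_le_card h
    have h2 := hG.two_lt_card_primeFactors
    have h3 := Finset.card_le_two (a := q) (b := s)
    omega
  obtain ⟨hpp, hpG, -⟩ := Nat.mem_primeFactors.1 hp
  have := Fact.mk hpp
  simp only [Finset.mem_insert, Finset.mem_singleton, not_or] at hpqs
  let P := sylowOf G p
  obtain ⟨x, hx, hx1⟩ := (bot_or_exists_ne_one _).resolve_left (sylow_ne_bot hpG P)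
  obtain ⟨Q, y, hy, hyP⟩ : ∃ Q : Sylow q G, ∃ y ∈ Q, y ∉ normalizer (P : Set G) := by
    by_contra! h
    have h1 : normalClosure (sylowOf G q : Set G) ≤ normalizer (P : Set G) := by
      refine (closure_le _).2 fun z hz ↦ ?_
      obtain ⟨w, hw, hwz⟩ := Group.mem_conjugatesOfSet_iff.1 hz
      obtain ⟨g, rfl⟩ := isConj_iff.1 hwz
      refine h (g • sylowOf G q) _ ?_
      rw [← SetLike.mem_coe, Sylow.coe_smul]
      exact ⟨w, hw, rfl⟩
    have h2 : normalClosure (sylowOf G q : Set G) ≠ ⊥ := fun h ↦ sylow_ne_bot hqG (sylowOf G q)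
      (le_bot_iff.1 (h ▸ le_normalClosure))
    rw [hG.eq_top_of_normal normalClosure_normal h2, top_le_iff] at h1
    exact hG.normalizer_ne_top hpp P.isPGroup' (sylow_ne_bot hpG P) h1
  refine ⟨x, y, ?_⟩
  by_contra htop
  have hxH : x ∈ closure {x, y} := subset_closure (by simp)
  have hyH : y ∈ closure {x, y} := subset_closure (by simp)
  have hy1 : y ≠ 1 := by rintro rfl; exact hyP (one_mem _)
  have hpx : IsPGroup p (zpowers x) := P.isPGroup'.to_le (zpowers_le.2 hx)
  have hqy : IsPGroup q (zpowers y) := Q.isPGroup'.to_le (zpowers_le.2 hy)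
  have hdvd : ∀ {r : ℕ} {z : G}, r.Prime → IsPGroup r (zpowers z) → z ≠ 1 → r ∣ orderOf z := by
    intro r z hr hz hz1
    have := Fact.mk hr
    obtain ⟨n, hn⟩ := IsPGroup.iff_card.1 hz
    rw [Nat.card_zpowers] at hn
    rw [hn]
    refine dvd_pow_self r fun h0 ↦ hz1 ?_
    rwa [h0, pow_zero, orderOf_eq_one_iff] at hn
  have hpo := hdvd hpp hpx hx1
  have hqo := hdvd hq hqy hy1
  have hord : ∀ {H : Subgroup G} {z : G}, z ∈ H → orderOf z ∣ Nat.card H := by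
    intro H z hz
    rw [← orderOf_mk z hz]; exact orderOf_dvd_natCard _
  obtain ⟨r, hr, T, -, hT1, hHT, hT, hmax, t, l, ht, hrt, hcard⟩ := hG.exists_normal_maximal htop
    (fun h ↦ hx1 (by rwa [h, mem_bot] at hxH))
  have := Fact.mk hr
  have hTmem : ∀ {z : G}, z ∈ closure {x, y} → IsPGroup r (zpowers z) → z ∈ T := fun hz hzp ↦
    hmax _ (zpowers_le.2 hz) hzp (mem_zpowers _)
  obtain ⟨m, hm⟩ := IsPGroup.iff_card.1 hT
  rw [hm] at hcard
  by_cases hrp : r = p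
  · subst hrp
    exact hyP (hG.normalizer_le_normalizer_sylow P hT hx (hTmem hxH hpx) hx1 (hHT hyH))
  by_cases hrq : r = q
  · subst hrq
    have h1 := hG.normalizer_le_normalizer_sylow Q hT hy (hTmem hyH hqy) hy1 (hHT hxH)
    have h2 := hpo.trans (hord h1)
    have h3 : Nat.card (normalizer (Q : Set G)) = Nat.card (normalizer (sylowOf G r : Set G)) := by
      have h4 := Sylow.card_eq_index_normalizer Q
      rw [Sylow.card_eq_index_normalizer (sylowOf G r)] at h4
      have h5 := index_mul_card (normalizer (Q : Set G))
      rw [← index_mul_card (normalizer (sylowOf G r : Set G)), h4] at h5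
      exact Nat.eq_of_mul_eq_mul_left (Nat.pos_of_ne_zero index_ne_zero_of_finite) h5
    obtain ⟨n, hn⟩ := IsPGroup.iff_card.1 (sylowOf G r).isPGroup'
    rw [h3, card_normalizer_sylowOf, hsk, hn] at h2
    rcases (hpp.dvd_mul).1 h2 with h | h
    · exact hpqs.1 ((Nat.prime_dvd_prime_iff_eq hpp hr).1 (hpp.dvd_of_dvd_pow h))
    · exact hpqs.2 ((Nat.prime_dvd_prime_iff_eq hpp hs).1 (hpp.dvd_of_dvd_pow h))
  · have key : ∀ {u : ℕ}, u.Prime → r ≠ u → u ∣ Nat.card (closure {x, y}) → u = t := by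
      intro u hu hru h
      rw [hcard] at h
      rcases (hu.dvd_mul).1 h with h | h
      · exact absurd ((Nat.prime_dvd_prime_iff_eq hu hr).1 (hu.dvd_of_dvd_pow h)).symm hru
      · exact (Nat.prime_dvd_prime_iff_eq hu ht).1 (hu.dvd_of_dvd_pow h)
    exact hpqs.1 ((key hpp hrp (hpo.trans (hord hxH))).trans
      (key hq hrq (hqo.trans (hord hyH))).symm)

theorem closure_singleton_ne_top (hG : MinimalCounterexample G) (s : G) : closure {s} ≠ ⊤ := by
  intro h
  obtain ⟨x, y, hxy⟩ := hG.exists_not_commute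
  have key : ∀ z : G, ∃ k : ℤ, s ^ k = z := fun z ↦ by
    have : z ∈ closure {s} := h ▸ mem_top z
    rwa [← zpowers_eq_closure] at this
  obtain ⟨k, rfl⟩ := key x
  obtain ⟨l, rfl⟩ := key y
  exact hxy ((Commute.refl s).zpow_zpow _ _)

theorem not_two_dvd_card (hG : MinimalCounterexample G) : ¬ 2 ∣ Nat.card G := by
  intro h2
  have := Fact.mk Nat.prime_two
  obtain ⟨s₀, hs₀⟩ := exists_prime_orderOf_dvd_card' 2 h2
  let I : Set G := {s | orderOf s = 2}
  have hI : closure I = ⊤ := by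
    refine hG.eq_top_of_normal ?_ fun h ↦ ?_
    · rw [← normalizer_eq_top_iff, eq_top_iff]
      refine le_trans ?_ (normalizer_le_normalizer_closure I)
      rw [le_set_normalizer_iff]
      intro g _ s hs
      have := (MulAut.conj g).orderOf_eq s
      exact this.trans hs
    · have : s₀ ∈ closure I := subset_closure hs₀
      rw [h, mem_bot] at this
      simp [this] at hs₀
  obtain ⟨X, hXI, hX, hXc⟩ := exists_irredundant_subset I
  obtain ⟨x, y, hxy⟩ := hG.exists_closure_pair_eq_top
  have hcard : X.ncard ≤ 2 :=
    (hG.basis X {x, y} hX (by rw [hXc, hI, hxy])).trans 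
      ((Set.ncard_insert_le x {y}).trans (by rw [Set.ncard_singleton]))
  obtain ⟨s, t, hs, ht, hXst⟩ : ∃ s t, s ∈ I ∧ t ∈ I ∧ X ⊆ {s, t} := by
    have h3 : X.ncard = 0 ∨ X.ncard = 1 ∨ X.ncard = 2 := by omega
    rcases h3 with h | h | h
    · rw [Set.ncard_eq_zero] at h
      exact ⟨s₀, s₀, hs₀, hs₀, by simp [h]⟩
    · obtain ⟨s, rfl⟩ := Set.ncard_eq_one.1 h
      exact ⟨s, s, hXI rfl, hXI rfl, by simp⟩
    · obtain ⟨s, t, -, rfl⟩ := Set.ncard_eq_two.1 h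
      exact ⟨s, t, hXI (by simp), hXI (by simp), subset_rfl⟩
  have hst : closure {s, t} = ⊤ := by
    rw [eq_top_iff, ← hI, ← hXc]
    exact closure_mono hXst
  have hss : s * s = 1 := by rw [← sq, ← hs, pow_orderOf_eq_one]
  have htt : t * t = 1 := by rw [← sq, ← ht, pow_orderOf_eq_one]
  have hsi : s⁻¹ = s := inv_eq_of_mul_eq_one_left hss
  have hti : t⁻¹ = t := inv_eq_of_mul_eq_one_left htt
  have hnorm : (zpowers (s * t)).Normal := by
    have hm : (s * t)⁻¹ ∈ zpowers (s * t) := inv_mem (mem_zpowers _)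
    rw [← normalizer_eq_top_iff, eq_top_iff, ← hst, zpowers_eq_closure, le_normalizer_closure_iff,
      ← zpowers_eq_closure]
    have hle : closure {s, t} ≤ normalizer (zpowers (s * t) : Set G) := by
      refine (closure_le _).2 ?_
      have key : ∀ g : G, g * (s * t) * g⁻¹ = (s * t)⁻¹ → g * g = 1 →
          g ∈ normalizer (zpowers (s * t) : Set G) := by
        intro g hg hgg
        have h1 : ∀ h ∈ zpowers (s * t), g * h * g⁻¹ ∈ zpowers (s * t) := by
          rintro _ ⟨k, rfl⟩
          refine ⟨-k, ?_⟩
          dsimp only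
          rw [← conj_zpow, hg, inv_zpow, zpow_neg]
        refine mem_normalizer_iff.2 fun h ↦ ⟨h1 h, fun hh ↦ ?_⟩
        have := h1 _ hh
        have h2 : g * (g * h * g⁻¹) * g⁻¹ = (g * g) * h * (g * g)⁻¹ := by group
        rwa [h2, hgg, one_mul, inv_one, mul_one] at this
      rintro g (rfl | rfl)
      · refine key _ ?_ hss
        rw [mul_inv_rev, hsi, hti, ← mul_assoc, hss, one_mul]
      · refine key _ ?_ htt
        rw [mul_inv_rev, hsi, hti, mul_assoc, mul_assoc, htt, mul_one]
    rintro g hg _ rfl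
    exact (mem_normalizer_iff.1 (hle hg) _).1 (mem_zpowers _)
  by_cases h1 : zpowers (s * t) = ⊥
  · rw [zpowers_eq_bot, mul_eq_one_iff_eq_inv, hti] at h1
    subst h1
    exact hG.closure_singleton_ne_top s (by simpa using hst)
  · have := hG.eq_top_of_normal hnorm h1
    rw [zpowers_eq_closure] at this
    exact hG.closure_singleton_ne_top _ this

end

end MinimalCounterexample

open Matrix

/-- The sum of the character values of a finite group is a multiple of its order. -/
theorem exists_sum_trace_eq {R κ : Type*} [Group R] [Fintype R] [Fintype κ] [DecidableEq κ]
    (ρ : R →* Matrix κ κ ℂ) : ∃ m : ℕ, ∑ x, (ρ x).trace = Fintype.card R * m := by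
  have hR : (Fintype.card R : ℂ) ≠ 0 := by exact_mod_cast Fintype.card_ne_zero
  set A : Matrix κ κ ℂ := (Fintype.card R : ℂ)⁻¹ • ∑ x, ρ x with hA
  have h1 : ∀ x, ρ x * ∑ y, ρ y = ∑ y, ρ y := fun x ↦ by
    simp_rw [Finset.mul_sum, ← map_mul]
    exact Fintype.sum_equiv (Equiv.mulLeft x) _ _ fun _ ↦ rfl
  have h2 : A * A = A := by
    rw [hA, smul_mul_assoc, mul_smul_comm, Finset.sum_mul]
    simp_rw [h1]
    rw [Finset.sum_const, Finset.card_univ, ← Nat.cast_smul_eq_nsmul ℂ,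
      smul_smul (Fintype.card R : ℂ)⁻¹ (Fintype.card R : ℂ),
      inv_mul_cancel₀ hR, one_smul]
  obtain ⟨p, hp⟩ := (LinearMap.isProj_iff_isIdempotentElem (toLin' A)).2
    (by rw [IsIdempotentElem, Module.End.mul_eq_comp, ← toLin'_mul, h2])
  have h3 := hp.trace
  rw [trace_toLin'_eq] at h3
  refine ⟨Module.finrank ℂ p, ?_⟩
  rw [← h3, hA, trace_smul, trace_sum, smul_eq_mul, mul_inv_cancel_left₀ hR]

theorem trace_linearMap_mulLeft_mulRight {κ : Type*} [Fintype κ] [DecidableEq κ]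
    {d : κ → ℕ} (A B : Π i, Matrix (Fin (d i)) (Fin (d i)) ℂ) :
    LinearMap.trace ℂ _ (LinearMap.mulLeft ℂ A ∘ₗ LinearMap.mulRight ℂ B) =
      ∑ i, (A i).trace * (B i).trace := by
  classical
  rw [LinearMap.trace_eq_matrix_trace ℂ
    (Pi.basis fun i ↦ Matrix.stdBasis ℂ (Fin (d i)) (Fin (d i)))]
  simp only [Matrix.trace, Matrix.diag, LinearMap.toMatrix_apply, Fintype.sum_sigma]
  refine Finset.sum_congr rfl fun i _ ↦ ?_
  rw [Finset.sum_mul_sum, Fintype.sum_prod_type]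
  refine Finset.sum_congr rfl fun a _ ↦ Finset.sum_congr rfl fun b _ ↦ ?_
  rw [Pi.basis_repr, Pi.basis_apply]
  rw [Matrix.stdBasis_eq_single]
  simp [Matrix.stdBasis, Matrix.mul_apply, Matrix.single_apply, ite_and]

theorem trace_mulLeft_mulRight_single {G : Type*} [Group G] [Fintype G] [DecidableEq G] (g h : G) :
    LinearMap.trace ℂ (MonoidAlgebra ℂ G) (LinearMap.mulLeft ℂ (MonoidAlgebra.of ℂ G g) ∘ₗ
      LinearMap.mulRight ℂ (MonoidAlgebra.of ℂ G h)) =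
      (Finset.univ.filter fun x ↦ g * x * h = x).card := by
  rw [LinearMap.trace_eq_matrix_trace ℂ (MonoidAlgebra.basis G ℂ)]
  simp only [Matrix.trace, Matrix.diag, LinearMap.toMatrix_apply, LinearMap.comp_apply,
    LinearMap.mulLeft_apply, LinearMap.mulRight_apply, MonoidAlgebra.basis_apply,
    MonoidAlgebra.of_apply, MonoidAlgebra.single_mul_single, mul_one]
  simp only [← MonoidAlgebra.basis_apply, Module.Basis.repr_self, Finsupp.single_apply]
  simp [mul_assoc]

/-- The irreducible complex characters of a finite group, together with the permutation given by
complex conjugation. -/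
structure CharacterTable (G : Type*) [Group G] where
  /-- The number of irreducible characters. -/
  size : ℕ
  /-- The irreducible characters. -/
  χ : Fin size → G → ℂ
  /-- The index of the trivial character. -/
  trivialIndex : Fin size
  /-- The permutation of the indices given by complex conjugation. -/
  conj : Fin size → Fin size
  sum_mul (g h : G) : ∑ i, χ i g * χ i h = {x : G | g * x * h = x}.ncard
  exists_sum_eq (R : Subgroup G) (μ : R →* ℂˣ) (i : Fin size) :
    ∃ m : ℕ, ∑ᶠ x : R, (μ x⁻¹ : ℂ) * χ i x = Nat.card R * m
  trivial (g : G) : χ trivialIndex g = 1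
  exists_degree (i : Fin size) : ∃ d : ℕ, 0 < d ∧ χ i 1 = d
  conj_conj (i : Fin size) : conj (conj i) = i
  χ_conj (i : Fin size) (g : G) : χ (conj i) g = χ i g⁻¹
  conj_trivialIndex : conj trivialIndex = trivialIndex
  eq_trivialIndex (hG : ¬ 2 ∣ Nat.card G) (i : Fin size) : conj i = i → i = trivialIndex

section

variable {G : Type*} [Group G] [Fintype G] {κ : Type*} [Fintype κ] [DecidableEq κ]

theorem exists_sum_character_eq {d : ℕ} (ρ : G →* Matrix (Fin d) (Fin d) ℂ)
    (R : Subgroup G) (μ : R →* ℂˣ) :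
    ∃ m : ℕ, ∑ᶠ x : R, (μ x⁻¹ : ℂ) * (ρ x).trace = Nat.card R * m := by
  classical
  have := Fintype.ofFinite R
  let τ : R →* Matrix (Fin d) (Fin d) ℂ :=
    { toFun := fun x ↦ ((μ x⁻¹ : ℂˣ) : ℂ) • ρ x
      map_one' := by simp
      map_mul' := fun x y ↦ by
        simp [smul_smul, mul_comm] }
  obtain ⟨m, hm⟩ := exists_sum_trace_eq τ
  refine ⟨m, ?_⟩
  rw [finsum_eq_sum_of_fintype, Nat.card_eq_fintype_card, ← hm]
  refine Finset.sum_congr rfl fun x _ ↦ ?_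
  change _ = (((μ x⁻¹ : ℂˣ) : ℂ) • ρ x).trace
  rw [trace_smul, smul_eq_mul]

theorem exists_sum_mul_eq {d d' : ℕ} (ρ : G →* Matrix (Fin d) (Fin d) ℂ)
    (ρ' : G →* Matrix (Fin d') (Fin d') ℂ) :
    ∃ m : ℕ, ∑ x, (ρ x).trace * (ρ' x).trace = Fintype.card G * m := by
  let τ : G →* Matrix (Fin d × Fin d') (Fin d × Fin d') ℂ :=
    { toFun := fun x ↦ kroneckerMap (· * ·) (ρ x) (ρ' x)
      map_one' := by simp
      map_mul' := fun x y ↦ by rw [map_mul, map_mul, mul_kronecker_mul] }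
  obtain ⟨m, hm⟩ := exists_sum_trace_eq τ
  exact ⟨m, hm ▸ Finset.sum_congr rfl fun x _ ↦ (trace_kronecker _ _).symm⟩

theorem sum_ncard_mul_eq (h : G) (f : G → ℂ) :
    ∑ g, f g * {x : G | g * x * h = x}.ncard = ∑ x, f (x * h⁻¹ * x⁻¹) := by
  classical
  have h1 : ∀ g : G, ({x : G | g * x * h = x}.ncard : ℂ) =
      ∑ x, if g = x * h⁻¹ * x⁻¹ then (1 : ℂ) else 0 := by
    intro g
    rw [Finset.sum_boole, ← Set.ncard_coe_finset]
    simp [eq_mul_inv_iff_mul_eq]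
  simp_rw [h1, Finset.mul_sum]
  rw [Finset.sum_comm]
  simp

end

theorem eq_one_of_mul_mul_eq {G : Type*} [Group G] [Finite G] (hG : ¬ 2 ∣ Nat.card G) {g x : G}
    (h : g * x * g = x) : g = 1 := by
  have h1 : (Nat.card G).Coprime 2 := Nat.Coprime.symm
    ((Nat.Prime.coprime_iff_not_dvd Nat.prime_two).2 hG)
  have h2 : (g * x) ^ 2 = x ^ 2 := by
    rw [sq, sq, ← mul_assoc, h]
  have h3 := (powCoprime h1).injective (a₁ := g * x) (a₂ := x) h2
  simpa using h3

theorem ncard_mul_mul_eq {G : Type*} [Group G] [Finite G] [DecidableEq G] (hG : ¬ 2 ∣ Nat.card G)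
    (g : G) :
    {x : G | g * x * g = x}.ncard = if g = 1 then Nat.card G else 0 := by
  split_ifs with h
  · subst h
    simp [Set.ncard_univ]
  · rw [Set.ncard_eq_zero, Set.eq_empty_iff_forall_notMem]
    exact fun x hx ↦ h (eq_one_of_mul_mul_eq hG hx)

theorem exists_of_sum_sq_eq_one {n : ℕ} {m : Fin n → ℕ} (h : ∑ i, m i * m i = 1) :
    ∃ i, m i = 1 ∧ ∀ j, j ≠ i → m j = 0 := by
  obtain ⟨i, -, hi⟩ : ∃ i ∈ Finset.univ, m i * m i ≠ 0 := by
    by_contra! h'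
    rw [Finset.sum_eq_zero h'] at h
    exact zero_ne_one h
  rw [← Finset.add_sum_erase _ _ (Finset.mem_univ i)] at h
  have h0 : m i ≠ 0 := fun h0 ↦ hi (by rw [h0])
  have h1 : 1 ≤ m i * m i := Nat.one_le_iff_ne_zero.2 hi
  have h2 : m i * m i = 1 := by omega
  refine ⟨i, Nat.eq_one_of_mul_eq_one_left h2, fun j hj ↦ ?_⟩
  have h3 : ∑ j ∈ Finset.univ.erase i, m j * m j = 0 := by omega
  have := Finset.sum_eq_zero_iff.1 h3 j (by simp [hj])
  exact mul_self_eq_zero.1 this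

theorem nonempty_characterTable (G : Type*) [Group G] [Finite G] :
    Nonempty (CharacterTable G) := by
  classical
  have := Fintype.ofFinite G
  have hN : (Fintype.card G : ℂ) ≠ 0 := by exact_mod_cast Fintype.card_ne_zero
  have hN' : Nat.card G = Fintype.card G := Nat.card_eq_fintype_card
  have : NeZero (Nat.card G : ℂ) := ⟨by rwa [hN']⟩
  obtain ⟨n, d, hd, ⟨e⟩⟩ := IsSemisimpleRing.exists_algEquiv_pi_matrix_of_isAlgClosed ℂ
    (MonoidAlgebra ℂ G)
  let ρ : ∀ i, G →* Matrix (Fin (d i)) (Fin (d i)) ℂ := fun i ↦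
    ((Pi.evalMonoidHom (fun i ↦ Matrix (Fin (d i)) (Fin (d i)) ℂ) i).comp
      (e : MonoidAlgebra ℂ G →* Π i, Matrix (Fin (d i)) (Fin (d i)) ℂ)).comp (MonoidAlgebra.of ℂ G)
  let χ : Fin n → G → ℂ := fun i g ↦ (ρ i g).trace
  have hχ1 : ∀ i, χ i 1 = d i := fun i ↦ by simp [χ]
  have sum_mul : ∀ g h : G, ∑ i, χ i g * χ i h = {x : G | g * x * h = x}.ncard := by
    intro g h
    have h1 := trace_linearMap_mulLeft_mulRight (e (MonoidAlgebra.of ℂ G g))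
      (e (MonoidAlgebra.of ℂ G h))
    have h2 := trace_mulLeft_mulRight_single g h
    rw [← LinearMap.trace_conj' _ e.toLinearEquiv] at h2
    refine h1.symm.trans (Eq.trans ?_ (h2.trans ?_))
    · congr 1
      refine LinearMap.ext fun x ↦ ?_
      simp [LinearEquiv.conj_apply]
    · rw [← Set.ncard_coe_finset]
      simp
  have indep : ∀ c : Fin n → ℂ, (∀ g, ∑ i, c i * χ i g = 0) → ∀ i, c i = 0 := by
    intro c hc i
    let F : MonoidAlgebra ℂ G →ₗ[ℂ] ℂ := ∑ i, c i • (Matrix.traceLinearMap (Fin (d i)) ℂ ℂ ∘ₗ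
      LinearMap.proj i ∘ₗ e.toLinearMap)
    have hF : F = 0 := by
      refine (MonoidAlgebra.basis G ℂ).ext fun g ↦ ?_
      simpa [F, χ, ρ] using hc g
    have h1 : F (e.symm (Pi.single i (Matrix.single 0 0 1))) = 0 := by rw [hF]; rfl
    have h2 : ∀ j, j ≠ i → (Pi.single i (Matrix.single 0 0 1) :
        Π i, Matrix (Fin (d i)) (Fin (d i)) ℂ) j = 0 := fun j hj ↦ Pi.single_eq_of_ne hj _
    simp only [F, LinearMap.sum_apply] at h1
    rw [Finset.sum_eq_single i] at h1
    · simpa using h1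
    · intro j _ hj
      simp [h2 j hj]
    · simp
  have inj : Function.Injective χ := by
    intro i j hij
    by_contra hne
    have := indep (Pi.single i 1 - Pi.single j 1) (fun g ↦ by
      simp [sub_mul, Finset.sum_sub_distrib, Pi.single_apply, hij]) i
    simp [Pi.single_eq_of_ne hne] at this
  obtain ⟨i₀, hi₀⟩ : ∃ i₀, ∀ g, χ i₀ g = 1 := by
    choose m hm using fun i ↦ exists_sum_trace_eq (ρ i)
    have h1 : ∀ h : G, ∑ i, (m i : ℂ) * χ i h = 1 := by
      intro h
      have h2 := sum_ncard_mul_eq h (fun _ ↦ 1)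
      simp_rw [← sum_mul, one_mul] at h2
      rw [Finset.sum_comm] at h2
      simp_rw [← Finset.sum_mul] at h2
      simp only [χ, hm, Finset.sum_const, Finset.card_univ, nsmul_eq_mul, mul_one] at h2
      simp_rw [mul_assoc, ← Finset.mul_sum] at h2
      exact mul_left_cancel₀ hN (h2.trans (mul_one _).symm)
    have h3 : ∑ i, m i * m i = 1 := by
      have h4 := Finset.sum_congr rfl fun h (_ : h ∈ (Finset.univ : Finset G)) ↦ h1 h
      rw [Finset.sum_comm] at h4
      simp_rw [← Finset.mul_sum] at h4
      simp only [χ, hm, Finset.sum_const, Finset.card_univ, nsmul_eq_mul, mul_one] at h4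
      simp_rw [mul_left_comm _ (Fintype.card G : ℂ), ← Finset.mul_sum] at h4
      have h5 := mul_left_cancel₀ hN (h4.trans (mul_one _).symm)
      exact_mod_cast h5
    obtain ⟨i, hi, hj⟩ := exists_of_sum_sq_eq_one h3
    refine ⟨i, fun g ↦ ?_⟩
    have := h1 g
    rwa [Finset.sum_eq_single i (fun j _ hji ↦ by simp [hj j hji]) (by simp), hi, Nat.cast_one,
      one_mul] at this
  choose T hT using fun i j ↦ exists_sum_mul_eq (ρ i) (ρ j)
  have hTχ : ∀ i h, ∑ j, (T i j : ℂ) * χ j h = χ i h⁻¹ := by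
    intro i h
    have h1 := sum_ncard_mul_eq h (χ i)
    simp_rw [← sum_mul, Finset.mul_sum, ← mul_assoc] at h1
    rw [Finset.sum_comm] at h1
    simp_rw [← Finset.sum_mul] at h1
    have h2 : ∀ x : G, χ i (x * h⁻¹ * x⁻¹) = χ i h⁻¹ := fun x ↦ by
      simp only [χ]
      rw [map_mul, Matrix.trace_mul_comm, ← map_mul]
      simp
    simp only [χ, hT] at h1
    simp only [χ] at h2
    simp only [h2, Finset.sum_const, Finset.card_univ, nsmul_eq_mul] at h1
    simp_rw [mul_assoc, ← Finset.mul_sum] at h1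
    exact mul_left_cancel₀ hN h1
  have hTsymm : ∀ i j, T i j = T j i := fun i j ↦ by
    have h1 := (hT i j).symm.trans ((Finset.sum_congr rfl fun x _ ↦ mul_comm _ _).trans (hT j i))
    exact_mod_cast mul_left_cancel₀ hN h1
  have hTT : ∀ i, ∑ j, T i j * T i j = 1 := by
    intro i
    have h1 := indep (fun k ↦ ∑ j, (T i j : ℂ) * T j k - if k = i then 1 else 0) (fun g ↦ by
      simp_rw [sub_mul, Finset.sum_sub_distrib, Finset.sum_mul]
      rw [Finset.sum_comm]
      simp_rw [mul_assoc, ← Finset.mul_sum, hTχ]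
      simp) i
    simp only [if_true] at h1
    rw [sub_eq_zero] at h1
    have h2 : ∑ j, T i j * T j i = 1 := by exact_mod_cast h1
    simpa only [hTsymm _ i] using h2
  choose σ hσ hσ' using fun i ↦ exists_of_sum_sq_eq_one (hTT i)
  have hσχ : ∀ i g, χ (σ i) g = χ i g⁻¹ := fun i g ↦ by
    rw [← hTχ, Finset.sum_eq_single (σ i) (fun j _ hj ↦ by simp [hσ' i j hj]) (by simp), hσ,
      Nat.cast_one, one_mul]
  have hσi : σ i₀ = i₀ := inj (funext fun g ↦ by rw [hσχ, hi₀, hi₀])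
  refine ⟨⟨n, χ, i₀, σ, sum_mul, fun R μ i ↦ exists_sum_character_eq (ρ i) R μ, hi₀, fun i ↦
    ⟨d i, Nat.pos_of_neZero _, hχ1 i⟩, fun i ↦ inj (funext fun g ↦ by rw [hσχ, hσχ, inv_inv]),
    hσχ, hσi, fun hG i hi ↦ ?_⟩⟩
  have h1 : ∑ i, T i i = 1 := by
    have h2 : ∑ g, ∑ i, χ i g * χ i g = Fintype.card G := by
      simp_rw [sum_mul, ncard_mul_mul_eq hG]
      simp
    rw [Finset.sum_comm] at h2
    simp only [χ, hT] at h2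
    rw [← Finset.mul_sum] at h2
    exact_mod_cast mul_left_cancel₀ hN (h2.trans (mul_one _).symm)
  by_contra hne
  have h2 : ∑ j ∈ {i, i₀}, T j j ≤ ∑ j, T j j :=
    Finset.sum_le_univ_sum_of_nonneg fun _ ↦ Nat.zero_le _
  rw [Finset.sum_pair hne, h1] at h2
  have h3 := hσ i
  have h4 := hσ i₀
  rw [hi] at h3
  rw [hσi] at h4
  omega

namespace CharacterTable

section

variable {G : Type*} [Group G] (T : CharacterTable G)

/-- The multiplicity of a linear character of a subgroup in the restriction of an irreducible
character. -/
noncomputable def mult {R : Subgroup G} (μ : R →* ℂˣ) (i : Fin T.size) : ℕ :=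
  (T.exists_sum_eq R μ i).choose

/-- The induced generalized character `Ind μ - Ind 1`, in the basis of irreducible characters. -/
noncomputable def inducedDiff {R : Subgroup G} (μ : R →* ℂˣ) (i : Fin T.size) : ℤ :=
  T.mult μ i - T.mult (1 : R →* ℂˣ) i

theorem card_mul_mult {R : Subgroup G} [Fintype R] (μ : R →* ℂˣ) (i : Fin T.size) :
    (Fintype.card R : ℂ) * T.mult μ i = ∑ x : R, (μ x⁻¹ : ℂ) * T.χ i x := by
  rw [← Nat.card_eq_fintype_card, ← finsum_eq_sum_of_fintype]
  exact (T.exists_sum_eq R μ i).choose_spec.symm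

theorem card_mul_inducedDiff {R : Subgroup G} [Fintype R] (μ : R →* ℂˣ) (i : Fin T.size) :
    (Fintype.card R : ℂ) * T.inducedDiff μ i = ∑ x : R, ((μ x⁻¹ : ℂ) - 1) * T.χ i x := by
  simp only [inducedDiff, Int.cast_sub, Int.cast_natCast, mul_sub, card_mul_mult, sub_mul,
    Finset.sum_sub_distrib, MonoidHom.one_apply, Units.val_one]

theorem sum_apply_eq_zero {R : Subgroup G} [Fintype R] {μ : R →* ℂˣ} (hμ : μ ≠ 1) :
    ∑ x : R, (μ x : ℂ) = 0 := by
  refine sum_hom_units_eq_zero ((Units.coeHom ℂ).comp μ) fun h ↦ hμ (MonoidHom.ext fun x ↦ ?_)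
  exact Units.ext (DFunLike.congr_fun h x)

theorem sum_apply_inv_eq_zero {R : Subgroup G} [Fintype R] {μ : R →* ℂˣ} (hμ : μ ≠ 1) :
    ∑ x : R, (μ x⁻¹ : ℂ) = 0 :=
  (Fintype.sum_equiv (Equiv.inv R) _ (fun x ↦ (μ x : ℂ)) fun _ ↦ rfl).trans (sum_apply_eq_zero hμ)

/-- The scalar product of two differences of induced characters, computed by Mackey's formula. -/
theorem card_mul_card_mul_dotProduct {R S : Subgroup G} [Fintype R] [Fintype S]
    (μ : R →* ℂˣ) (ν : S →* ℂˣ) :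
    (Fintype.card R : ℂ) * Fintype.card S * (T.inducedDiff μ ⬝ᵥ T.inducedDiff ν : ℤ) =
      ∑ x : R, ∑ y : S, ((μ x : ℂ) - 1) * ((ν y⁻¹ : ℂ) - 1) *
        {g : G | g * y * g⁻¹ = x}.ncard := by
  have h1 : (Fintype.card R : ℂ) * Fintype.card S * (T.inducedDiff μ ⬝ᵥ T.inducedDiff ν : ℤ) =
      ∑ i, ((Fintype.card R : ℂ) * T.inducedDiff μ i) *
        ((Fintype.card S : ℂ) * T.inducedDiff ν i) := by
    rw [dotProduct, Int.cast_sum, Finset.mul_sum]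
    refine Finset.sum_congr rfl fun i _ ↦ ?_
    push_cast
    ring
  rw [h1]
  simp_rw [card_mul_inducedDiff, Finset.sum_mul_sum]
  rw [Finset.sum_comm]
  refine Fintype.sum_equiv (Equiv.inv R) _ _ fun x ↦ ?_
  rw [Finset.sum_comm]
  refine Finset.sum_congr rfl fun y _ ↦ ?_
  have h2 : {g : G | g * y * g⁻¹ = ((Equiv.inv R x : R) : G)} =
      {g : G | (x : G) * g * (y : G) = g} := by
    ext g
    change g * y * g⁻¹ = ((x⁻¹ : R) : G) ↔ (x : G) * g * (y : G) = g
    rw [coe_inv, eq_comm, inv_eq_iff_mul_eq_one, ← mul_assoc, ← mul_assoc, mul_inv_eq_one]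
  rw [h2, ← T.sum_mul, Finset.mul_sum]
  refine Finset.sum_congr rfl fun i _ ↦ ?_
  simp only [Equiv.inv_apply]
  ring

variable [Finite G]

theorem inducedDiff_trivialIndex {R : Subgroup G} {μ : R →* ℂˣ} (hμ : μ ≠ 1) :
    T.inducedDiff μ T.trivialIndex = -1 := by
  have := Fintype.ofFinite R
  have hR : (Fintype.card R : ℂ) ≠ 0 := by exact_mod_cast Fintype.card_ne_zero
  have h := T.card_mul_inducedDiff μ T.trivialIndex
  simp only [T.trivial, mul_one, Finset.sum_sub_distrib, sum_apply_inv_eq_zero hμ] at h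
  have h2 : (Fintype.card R : ℂ) * T.inducedDiff μ T.trivialIndex = Fintype.card R * (-1) := by
    rw [h]; simp
  exact_mod_cast mul_left_cancel₀ hR h2

theorem inducedDiff_conj {R : Subgroup G} (μ : R →* ℂˣ) (i : Fin T.size) :
    T.inducedDiff μ (T.conj i) = T.inducedDiff μ⁻¹ i := by
  have := Fintype.ofFinite R
  have hR : (Fintype.card R : ℂ) ≠ 0 := by exact_mod_cast Fintype.card_ne_zero
  have h : (Fintype.card R : ℂ) * T.inducedDiff μ (T.conj i) =
      Fintype.card R * T.inducedDiff μ⁻¹ i := by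
    rw [card_mul_inducedDiff, card_mul_inducedDiff]
    refine Fintype.sum_equiv (Equiv.inv R) _ _ fun x ↦ ?_
    simp [T.χ_conj]
  exact_mod_cast mul_left_cancel₀ hR h

theorem sum_inducedDiff_mul_χ_one {R : Subgroup G} (μ : R →* ℂˣ) :
    ∑ i, (T.inducedDiff μ i : ℂ) * T.χ i 1 = 0 := by
  classical
  have := Fintype.ofFinite R
  have hR : (Fintype.card R : ℂ) ≠ 0 := by exact_mod_cast Fintype.card_ne_zero
  refine (mul_eq_zero_iff_left hR).1 ?_
  simp_rw [Finset.mul_sum, ← mul_assoc, card_mul_inducedDiff, Finset.sum_mul]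
  rw [Finset.sum_comm]
  refine Finset.sum_eq_zero fun x _ ↦ ?_
  simp_rw [mul_assoc, ← Finset.mul_sum, T.sum_mul]
  by_cases hx : x = 1
  · simp [hx]
  · have : (x : G) ≠ 1 := fun h ↦ hx (Subtype.ext h)
    simp [this]

end

end CharacterTable

/-- The conjugate of a linear character of a subgroup by an element of the normalizer. -/
def conjChar {G : Type*} [Group G] {R : Subgroup G} (n : normalizer (R : Set G)) (μ : R →* ℂˣ) :
    R →* ℂˣ := μ.comp (R.normalizerMonoidHom n).toMonoidHom

section

variable {G : Type*} [Group G] {R : Subgroup G}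

theorem conjChar_apply (n : normalizer (R : Set G)) (μ : R →* ℂˣ) (x : R) :
    conjChar n μ x = μ (n • x) := rfl

theorem conjChar_mul (m n : normalizer (R : Set G)) (μ : R →* ℂˣ) :
    conjChar (m * n) μ = conjChar n (conjChar m μ) :=
  MonoidHom.ext fun x ↦ by simp only [conjChar_apply, mul_smul]

theorem conjChar_one (μ : R →* ℂˣ) : conjChar 1 μ = μ :=
  MonoidHom.ext fun x ↦ by simp only [conjChar_apply, one_smul]

theorem conjChar_eq_iff {m : normalizer (R : Set G)} {μ ν : R →* ℂˣ} :
    conjChar m μ = ν ↔ conjChar m⁻¹ ν = μ := by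
  constructor <;> rintro rfl <;> rw [← conjChar_mul] <;> simp [conjChar_one]

theorem conjChar_eq_one_iff {m : normalizer (R : Set G)} {μ : R →* ℂˣ} :
    conjChar m μ = 1 ↔ μ = 1 := by
  rw [conjChar_eq_iff, eq_comm]
  rfl

end

namespace MinimalCounterexample

section

variable {G : Type*} [Group G] [Finite G] {p : ℕ} [Fact p.Prime]

theorem conjChar_eq_self_iff (hG : MinimalCounterexample G) (P : Sylow p G)
    {μ : (P : Subgroup G) →* ℂˣ} (hμ : μ ≠ 1) (n : normalizer ((P : Subgroup G) : Set G)) :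
    conjChar n μ = μ ↔ (n : G) ∈ P := by
  constructor
  · intro h
    by_contra hn
    apply hμ
    let F : ↥(P : Subgroup G) → ↥(P : Subgroup G) := fun x ↦ (n • x) * x⁻¹
    have hF : Function.Injective F := by
      intro x y hxy
      have h1 : (n : G) * x * (n : G)⁻¹ * (x : G)⁻¹ = n * y * (n : G)⁻¹ * (y : G)⁻¹ :=
        congrArg Subtype.val hxy
      have h2 : Commute (n : G) ((y : G)⁻¹ * x) := by
        have h3 : (x : G) * (n : G)⁻¹ * (x : G)⁻¹ = y * (n : G)⁻¹ * (y : G)⁻¹ := by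
          simpa [mul_assoc] using h1
        have h4 : (x : G) * n * (x : G)⁻¹ = y * n * (y : G)⁻¹ := by
          have := congrArg (·⁻¹) h3
          simpa [mul_assoc] using this
        have h5 : (y : G)⁻¹ * (x * n * (x : G)⁻¹) * x = (y : G)⁻¹ * (y * n * (y : G)⁻¹) * x := by
          rw [h4]
        rw [Commute, SemiconjBy]
        simpa [mul_assoc] using h5.symm
      have h6 := hG.eq_one_of_commute_normalizer P n.2 hn
        (mul_mem (inv_mem y.2) x.2) h2
      exact Subtype.ext (inv_mul_eq_one.1 h6).symm
    refine MonoidHom.ext fun z ↦ ?_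
    obtain ⟨x, rfl⟩ := (Finite.injective_iff_surjective.1 hF) z
    have := DFunLike.congr_fun h x
    rw [conjChar_apply] at this
    rw [map_mul, this, map_inv, mul_inv_cancel, MonoidHom.one_apply]
  · intro h
    refine MonoidHom.ext fun x ↦ ?_
    have : (n • x : (P : Subgroup G)) = ⟨n, h⟩ * x * ⟨n, h⟩⁻¹ := Subtype.ext rfl
    rw [conjChar_apply, this, map_mul, map_mul, map_inv, mul_inv_cancel_comm]

theorem ncard_conjChar_eq (hG : MinimalCounterexample G) (P : Sylow p G)
    {μ : (P : Subgroup G) →* ℂˣ} (hμ : μ ≠ 1) (m : normalizer ((P : Subgroup G) : Set G)) :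
    {n : normalizer ((P : Subgroup G) : Set G) | conjChar n μ = conjChar m μ}.ncard =
      Nat.card P := by
  symm
  refine Nat.card_congr ?_
  refine Equiv.ofBijective (fun x ↦ ⟨⟨x, le_normalizer x.2⟩ * m, ?_⟩) ⟨?_, ?_⟩
  · change conjChar _ μ = _
    rw [conjChar_mul, (hG.conjChar_eq_self_iff P hμ _).2 x.2]
  · intro x y hxy
    have := congrArg (fun z ↦ ((z.1 : normalizer ((P : Subgroup G) : Set G)) : G)) hxy
    exact Subtype.ext (mul_right_cancel this)
  · rintro ⟨n, hn⟩
    have h1 : conjChar (n * m⁻¹) μ = μ := by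
      rw [conjChar_mul, show conjChar n μ = _ from hn, ← conjChar_mul, mul_inv_cancel,
        conjChar_one]
    refine ⟨⟨_, (hG.conjChar_eq_self_iff P hμ _).1 h1⟩, Subtype.ext (Subtype.ext ?_)⟩
    simp

theorem ncard_mul_mul_inv_eq (hG : MinimalCounterexample G) (P : Sylow p G)
    {x y : (P : Subgroup G)} (hy : y ≠ 1) : {g : G | g * y * g⁻¹ = x}.ncard =
      {n : normalizer ((P : Subgroup G) : Set G) | n • y = x}.ncard := by
  symm
  refine Set.ncard_congr (fun n _ ↦ n) (fun n hn ↦ congrArg Subtype.val hn)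
    (fun m n _ _ h ↦ Subtype.ext h) fun g hg ↦ ?_
  have hg' : g * y * g⁻¹ = x := hg
  exact ⟨⟨g, hG.mem_normalizer_of_conj_mem P y.2 (fun h ↦ hy (Subtype.ext h)) (hg' ▸ x.2)⟩,
    Subtype.ext hg, rfl⟩

theorem dotProduct_inducedDiff_of_ne (T : CharacterTable G)
    {q : ℕ} [Fact q.Prime] (hpq : p ≠ q) (P : Sylow p G) (Q : Sylow q G)
    (μ : (P : Subgroup G) →* ℂˣ) (ν : (Q : Subgroup G) →* ℂˣ) :
    T.inducedDiff μ ⬝ᵥ T.inducedDiff ν = 0 := by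
  have := Fintype.ofFinite (P : Subgroup G)
  have := Fintype.ofFinite (Q : Subgroup G)
  have h := T.card_mul_card_mul_dotProduct μ ν
  rw [Finset.sum_eq_zero] at h
  · have hP : (Fintype.card (P : Subgroup G) : ℂ) ≠ 0 := by exact_mod_cast Fintype.card_ne_zero
    have hQ : (Fintype.card (Q : Subgroup G) : ℂ) ≠ 0 := by exact_mod_cast Fintype.card_ne_zero
    exact_mod_cast (mul_eq_zero_iff_left (mul_ne_zero hP hQ)).1 h
  · refine fun x _ ↦ Finset.sum_eq_zero fun y _ ↦ ?_
    by_cases hx : x = 1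
    · simp [hx]
    rw [(Set.ncard_eq_zero).2, Nat.cast_zero, mul_zero]
    refine Set.eq_empty_iff_forall_notMem.2 fun g hg ↦ hx ?_
    have hg' : g * y * g⁻¹ = x := hg
    have h1 : orderOf (g * y * g⁻¹) = orderOf (y : G) := (MulAut.conj g).orderOf_eq _
    have h2 := coprime_orderOf Fact.out Fact.out hpq P.isPGroup' Q.isPGroup' x.2 y.2
    rw [← h1, hg', Nat.coprime_self, orderOf_eq_one_iff] at h2
    exact Subtype.ext h2

theorem card_mul_dotProduct_inducedDiff (hG : MinimalCounterexample G) (T : CharacterTable G)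
    (P : Sylow p G) {μ ν : (P : Subgroup G) →* ℂˣ} (hμ : μ ≠ 1) (hν : ν ≠ 1) :
    (Nat.card P : ℤ) * (T.inducedDiff μ ⬝ᵥ T.inducedDiff ν) =
      Nat.card (normalizer ((P : Subgroup G) : Set G)) + {n | conjChar n μ = ν}.ncard := by
  classical
  have := Fintype.ofFinite (P : Subgroup G)
  have := Fintype.ofFinite (normalizer ((P : Subgroup G) : Set G))
  have hP : (Fintype.card (P : Subgroup G) : ℂ) ≠ 0 := by exact_mod_cast Fintype.card_ne_zero
  have h := T.card_mul_card_mul_dotProduct μ ν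
  have h1 : ∀ y : (P : Subgroup G), ∑ x : (P : Subgroup G), ((μ x : ℂ) - 1) * ((ν y⁻¹ : ℂ) - 1) *
      {g : G | g * y * g⁻¹ = x}.ncard =
      ∑ n : normalizer ((P : Subgroup G) : Set G), ((μ (n • y) : ℂ) - 1) * ((ν y⁻¹ : ℂ) - 1) := by
    intro y
    by_cases hy : y = 1
    · simp [hy]
    have h2 : ∀ x : (P : Subgroup G), ({g : G | g * y * g⁻¹ = x}.ncard : ℂ) =
        ∑ n : normalizer ((P : Subgroup G) : Set G), if n • y = x then (1 : ℂ) else 0 := by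
      intro x
      rw [hG.ncard_mul_mul_inv_eq P hy, Finset.sum_boole, ← Set.ncard_coe_finset]
      simp
    simp_rw [h2, Finset.mul_sum]
    rw [Finset.sum_comm]
    simp
  have h3 : ∀ n : normalizer ((P : Subgroup G) : Set G),
      ∑ y : (P : Subgroup G), ((μ (n • y) : ℂ) - 1) * ((ν y⁻¹ : ℂ) - 1) =
      Fintype.card (P : Subgroup G) * (if conjChar n μ = ν then 1 else 0) +
        Fintype.card (P : Subgroup G) := by
    intro n
    have h4 := CharacterTable.sum_apply_eq_zero (conjChar_eq_one_iff (m := n).not.2 hμ)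
    have h5 : ∑ y : (P : Subgroup G), ((μ (n • y) : ℂ) * (ν y⁻¹ : ℂ)) =
        Fintype.card (P : Subgroup G) * (if conjChar n μ = ν then 1 else 0) := by
      split_ifs with hn
      · simp only [← conjChar_apply, hn]
        simp
      · rw [mul_zero]
        refine Eq.trans (Finset.sum_congr rfl fun y _ ↦ ?_) (CharacterTable.sum_apply_eq_zero
          (μ := conjChar n μ * ν⁻¹) (fun h ↦ hn (mul_inv_eq_one.1 h)))
        rw [MonoidHom.mul_apply, conjChar_apply, MonoidHom.inv_apply, map_inv, Units.val_mul]
    simp_rw [conjChar_apply] at h4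
    simp only [sub_mul, mul_sub, Finset.sum_sub_distrib, h5, h4, one_mul, mul_one,
      CharacterTable.sum_apply_inv_eq_zero hν]
    simp
  rw [Finset.sum_comm] at h
  simp_rw [h1] at h
  rw [Finset.sum_comm] at h
  simp_rw [h3] at h
  rw [Finset.sum_add_distrib, ← Finset.mul_sum, Finset.sum_const, Finset.card_univ, nsmul_eq_mul,
    Finset.sum_boole, mul_assoc, mul_comm (_ : ℂ) (Fintype.card (P : Subgroup G) : ℂ),
      ← mul_add] at h
  have h6 := mul_left_cancel₀ hP h
  have h7 : {n | conjChar n μ = ν}.ncard =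
      (Finset.univ.filter fun n : normalizer ((P : Subgroup G) : Set G) ↦ conjChar n μ = ν).card := by
    rw [← Set.ncard_coe_finset]
    simp
  have h8 : Nat.card P = Fintype.card (P : Subgroup G) := Nat.card_eq_fintype_card
  rw [h7, h8, add_comm, Nat.card_eq_fintype_card (α := normalizer ((P : Subgroup G) : Set G))]
  exact_mod_cast h6

end

end MinimalCounterexample

instance {G : Type*} [Group G] [Finite G] : Finite (G →* ℂˣ) := by
  have : NeZero (Monoid.exponent (Abelianization G) : ℂ) :=
    ⟨by exact_mod_cast Monoid.exponent_ne_zero_of_finite⟩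
  have h := CommGroup.card_monoidHom_of_hasEnoughRootsOfUnity (Abelianization G) ℂ
  have := Nat.finite_of_card_ne_zero (h.trans_ne Nat.card_pos.ne')
  exact Finite.of_equiv _ Abelianization.lift.symm

theorem natCard_linearCharacters {G : Type*} [Group G] [Finite G] :
    Nat.card (G →* ℂˣ) = Nat.card (Abelianization G) := by
  have : NeZero (Monoid.exponent (Abelianization G) : ℂ) :=
    ⟨by exact_mod_cast Monoid.exponent_ne_zero_of_finite⟩
  rw [← CommGroup.card_monoidHom_of_hasEnoughRootsOfUnity (Abelianization G) ℂ]
  exact Nat.card_congr Abelianization.lift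

theorem exists_natCard_linearCharacters_eq {G : Type*} [Group G] [Finite G] [Nontrivial G] {p : ℕ}
    [Fact p.Prime] (hG : IsPGroup p G) : ∃ k ≠ 0, Nat.card (G →* ℂˣ) = p ^ k := by
  rw [natCard_linearCharacters]
  obtain ⟨k, hk⟩ := IsPGroup.iff_card.1 (hG.of_surjective (Abelianization.of (G := G))
    (QuotientGroup.mk'_surjective _))
  refine ⟨k, ?_, hk⟩
  rintro rfl
  have hnil : Group.IsNilpotent G := hG.isNilpotent
  refine (Group.IsSolvable.commutator_lt_top_of_nontrivial G).ne (index_eq_one.1 ?_)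
  rw [← hk.trans (pow_zero p)]
  rfl

namespace MinimalCounterexample

section

variable {G : Type*} [Group G] [Finite G]

/-- The vectors `Ind μ - Ind 1` for the nontrivial linear characters `μ` of a Sylow subgroup. -/
noncomputable def diffs (T : CharacterTable G) (p : ℕ) : Finset (Fin T.size → ℤ) :=
  ((Set.toFinite {μ : (sylowOf G p : Subgroup G) →* ℂˣ | μ ≠ 1}).image T.inducedDiff).toFinset

theorem mem_diffs {T : CharacterTable G} {p : ℕ} {v : Fin T.size → ℤ} : v ∈ diffs T p ↔
    ∃ μ : (sylowOf G p : Subgroup G) →* ℂˣ, μ ≠ 1 ∧ T.inducedDiff μ = v := by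
  simp [diffs]

theorem comp_conj_mem_diffs {T : CharacterTable G} {p : ℕ} {v : Fin T.size → ℤ}
    (hv : v ∈ diffs T p) : v ∘ T.conj ∈ diffs T p := by
  obtain ⟨μ, hμ, rfl⟩ := mem_diffs.1 hv
  exact mem_diffs.2 ⟨μ⁻¹, fun h ↦ hμ (MonoidHom.ext fun x ↦
    inv_eq_one.1 (DFunLike.congr_fun h x)), funext fun i ↦ (T.inducedDiff_conj μ i).symm⟩

theorem apply_trivialIndex_of_mem_diffs {T : CharacterTable G} {p : ℕ} {v : Fin T.size → ℤ}
    (hv : v ∈ diffs T p) : v T.trivialIndex = -1 := by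
  obtain ⟨μ, hμ, rfl⟩ := mem_diffs.1 hv
  exact T.inducedDiff_trivialIndex hμ

variable {p : ℕ} [Fact p.Prime]

open Classical in
theorem dotProduct_inducedDiff (hG : MinimalCounterexample G) (T : CharacterTable G)
    {μ ν : (sylowOf G p : Subgroup G) →* ℂˣ} (hμ : μ ≠ 1) (hν : ν ≠ 1) :
    T.inducedDiff μ ⬝ᵥ T.inducedDiff ν =
      sylowIndex G p + if ∃ n, conjChar n μ = ν then 1 else 0 := by
  have h := hG.card_mul_dotProduct_inducedDiff T (sylowOf G p) hμ hν
  have hc : (Nat.card (sylowOf G p) : ℤ) ≠ 0 := by exact_mod_cast Nat.card_pos.ne'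
  have h2 : Nat.card (normalizer ((sylowOf G p : Subgroup G) : Set G)) =
    Nat.card (sylowOf G p) * sylowIndex G p := card_normalizer_sylowOf p
  apply mul_left_cancel₀ hc
  rw [h, h2]
  split_ifs with hn
  · obtain ⟨m, rfl⟩ := hn
    rw [hG.ncard_conjChar_eq _ hμ]
    push_cast
    ring
  · have h3 : {n | conjChar n μ = ν} = ∅ :=
      Set.eq_empty_iff_forall_notMem.2 fun n h ↦ hn ⟨n, h⟩
    rw [h3, Set.ncard_empty]
    push_cast
    ring

theorem inducedDiff_eq_iff (hG : MinimalCounterexample G) (T : CharacterTable G)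
    {μ ν : (sylowOf G p : Subgroup G) →* ℂˣ} (hμ : μ ≠ 1) (hν : ν ≠ 1) :
    T.inducedDiff μ = T.inducedDiff ν ↔ ∃ n, conjChar n μ = ν := by
  have h1 : ∃ n, conjChar n μ = μ := ⟨1, conjChar_one μ⟩
  have h2 : ∃ n, conjChar n ν = ν := ⟨1, conjChar_one ν⟩
  have e1 := hG.dotProduct_inducedDiff T hμ hμ
  have e2 := hG.dotProduct_inducedDiff T hν hν
  have e3 := hG.dotProduct_inducedDiff T hμ hν
  rw [if_pos h1] at e1
  rw [if_pos h2] at e2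
  constructor
  · intro h
    by_contra hn
    rw [if_neg hn, ← h, e1] at e3
    omega
  · intro hn
    rw [if_pos hn] at e3
    rw [← sub_eq_zero, ← dotProduct_self_eq_zero]
    simp only [sub_dotProduct, dotProduct_sub]
    rw [dotProduct_comm (T.inducedDiff ν) (T.inducedDiff μ), e1, e2, e3]
    ring

theorem dotProduct_self_of_mem_diffs (hG : MinimalCounterexample G) {T : CharacterTable G}
    {v : Fin T.size → ℤ} (hv : v ∈ diffs T p) : v ⬝ᵥ v = sylowIndex G p + 1 := by
  classical
  obtain ⟨μ, hμ, rfl⟩ := mem_diffs.1 hv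
  rw [hG.dotProduct_inducedDiff T hμ hμ, if_pos ⟨1, conjChar_one μ⟩]

theorem dotProduct_of_mem_diffs (hG : MinimalCounterexample G) {T : CharacterTable G}
    {v w : Fin T.size → ℤ} (hv : v ∈ diffs T p) (hw : w ∈ diffs T p) (hvw : v ≠ w) :
    v ⬝ᵥ w = sylowIndex G p := by
  classical
  obtain ⟨μ, hμ, rfl⟩ := mem_diffs.1 hv
  obtain ⟨ν, hν, rfl⟩ := mem_diffs.1 hw
  rw [hG.dotProduct_inducedDiff T hμ hν, if_neg, add_zero]
  rwa [← hG.inducedDiff_eq_iff T hμ hν]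

theorem ncard_inducedDiff_eq (hG : MinimalCounterexample G) {T : CharacterTable G}
    {μ : (sylowOf G p : Subgroup G) →* ℂˣ} (hμ : μ ≠ 1) :
    {ν : (sylowOf G p : Subgroup G) →* ℂˣ | ν ≠ 1 ∧ T.inducedDiff ν = T.inducedDiff μ}.ncard =
      sylowIndex G p := by
  classical
  have h1 : {ν : (sylowOf G p : Subgroup G) →* ℂˣ | ν ≠ 1 ∧ T.inducedDiff ν = T.inducedDiff μ} =
      {ν | ∃ n, conjChar n μ = ν} := by
    ext ν
    constructor
    · rintro ⟨hν, h⟩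
      exact (hG.inducedDiff_eq_iff T hμ hν).1 h.symm
    · rintro ⟨n, rfl⟩
      have hn := conjChar_eq_one_iff (m := n).not.2 hμ
      exact ⟨hn, ((hG.inducedDiff_eq_iff T hμ hn).2 ⟨n, rfl⟩).symm⟩
  rw [h1]
  have := Fintype.ofFinite ((sylowOf G p : Subgroup G) →* ℂˣ)
  have := Fintype.ofFinite (normalizer ((sylowOf G p : Subgroup G) : Set G))
  have h2 : Nat.card (normalizer ((sylowOf G p : Subgroup G) : Set G)) =
    Nat.card (sylowOf G p) * sylowIndex G p := card_normalizer_sylowOf p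
  have h3 := Finset.card_eq_sum_card_image (fun n ↦ conjChar n μ)
    (Finset.univ : Finset (normalizer ((sylowOf G p : Subgroup G) : Set G)))
  rw [Finset.card_univ, ← Nat.card_eq_fintype_card, h2,
    Finset.sum_const_nat (m := Nat.card (sylowOf G p)),
    mul_comm] at h3
  · rw [Nat.eq_of_mul_eq_mul_right Nat.card_pos h3, ← Set.ncard_coe_finset]
    congr 1
    ext
    simp
  · intro ν hν
    obtain ⟨m, -, rfl⟩ := Finset.mem_image.1 hν
    rw [← hG.ncard_conjChar_eq (sylowOf G p) hμ m, ← Set.ncard_coe_finset]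
    congr 1
    ext
    simp

theorem natCard_linearCharacters_sylowOf (hG : MinimalCounterexample G) (T : CharacterTable G) :
    Nat.card ((sylowOf G p : Subgroup G) →* ℂˣ) = (diffs T p).card * sylowIndex G p + 1 := by
  classical
  have := Fintype.ofFinite ((sylowOf G p : Subgroup G) →* ℂˣ)
  have h3 := Finset.card_eq_sum_card_fiberwise (f := fun μ ↦ T.inducedDiff μ)
    (s := Finset.univ.erase (1 : (sylowOf G p : Subgroup G) →* ℂˣ)) (t := diffs T p)
    (fun μ hμ ↦ mem_diffs.2 ⟨μ, by simpa using hμ, rfl⟩)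
  rw [Finset.card_erase_of_mem (Finset.mem_univ _), Finset.card_univ, ← Nat.card_eq_fintype_card,
    Finset.sum_const_nat (m := sylowIndex G p)] at h3
  · rw [← h3, Nat.sub_add_cancel Nat.card_pos]
  · intro v hv
    obtain ⟨μ, hμ, rfl⟩ := mem_diffs.1 hv
    rw [← hG.ncard_inducedDiff_eq (T := T) hμ, ← Set.ncard_coe_finset]
    congr 1
    ext
    simp

theorem dotProduct_eq_zero_of_mem_diffs {T : CharacterTable G} {q : ℕ} [Fact q.Prime] (hpq : p ≠ q)
    {v w : Fin T.size → ℤ} (hv : v ∈ diffs T p) (hw : w ∈ diffs T q) : v ⬝ᵥ w = 0 := by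
  obtain ⟨μ, hμ, rfl⟩ := mem_diffs.1 hv
  obtain ⟨ν, hν, rfl⟩ := mem_diffs.1 hw
  exact dotProduct_inducedDiff_of_ne T hpq _ _ μ ν

end

end MinimalCounterexample

section

variable {ι : Type*} [Fintype ι] [DecidableEq ι]

/-- An integral vector of norm two and degree zero is a difference of two basis vectors. -/
theorem exists_eq_single_sub_single {d u : ι → ℤ} (hd : ∀ i, 0 < d i) (hud : u ⬝ᵥ d = 0)
    (hu : u ⬝ᵥ u = 2) : ∃ x y, x ≠ y ∧ u = Pi.single x 1 - Pi.single y 1 := by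
  have hu0 : u ≠ 0 := by rintro rfl; simp at hu
  have hex : ∀ u : ι → ℤ, u ≠ 0 → u ⬝ᵥ d = 0 → ∃ x, 0 < u x := by
    intro u hu0 hud
    by_contra! h
    apply hu0
    have h1 : ∀ i ∈ Finset.univ, u i * d i ≤ 0 := fun i _ ↦
      mul_nonpos_of_nonpos_of_nonneg (h i) (hd i).le
    have h2 := (Finset.sum_eq_zero_iff_of_nonpos h1).1 hud
    exact funext fun i ↦ (mul_eq_zero.1 (h2 i (Finset.mem_univ _))).resolve_right (hd i).ne'
  obtain ⟨x, hx⟩ := hex u hu0 hud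
  obtain ⟨y, hy⟩ := hex (-u) (neg_ne_zero.2 hu0) (by rw [neg_dotProduct, hud, neg_zero])
  have hy' : u y < 0 := by simpa using hy
  have hxy : x ≠ y := by rintro rfl; omega
  have h1 : u ⬝ᵥ u = u x * u x + (u y * u y + ∑ i ∈ (Finset.univ.erase x).erase y, u i * u i) := by
    rw [Finset.add_sum_erase _ (fun i ↦ u i * u i) (by simp [hxy.symm]),
      Finset.add_sum_erase _ (fun i ↦ u i * u i) (Finset.mem_univ x), dotProduct]
  have h2 : 0 ≤ ∑ i ∈ (Finset.univ.erase x).erase y, u i * u i :=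
    Finset.sum_nonneg fun i _ ↦ mul_self_nonneg _
  have h3 : 1 ≤ u x * u x := by nlinarith
  have h4 : 1 ≤ u y * u y := by nlinarith
  have h5 : u x = 1 := by nlinarith
  have h6 : u y = -1 := by nlinarith
  have h7 : ∑ i ∈ (Finset.univ.erase x).erase y, u i * u i = 0 := by
    rw [h5, h6] at h1; linarith
  refine ⟨x, y, hxy, funext fun i ↦ ?_⟩
  by_cases hix : i = x
  · subst hix; simp [h5, Pi.single_eq_of_ne hxy]
  by_cases hiy : i = y
  · subst hiy; simp [h6, Pi.single_eq_of_ne hxy.symm]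
  · have := (Finset.sum_eq_zero_iff_of_nonneg fun i _ ↦ mul_self_nonneg (u i)).1 h7 i
      (by simp [hix, hiy])
    simp [mul_self_eq_zero.1 this, hix, hiy]

/-- Coherence: a family of integral vectors of degree zero whose pairwise differences have norm
two is a translate of a set of signed basis vectors. -/
theorem exists_coherent [Nonempty ι] {d : ι → ℤ} (hd : ∀ i, 0 < d i) {V : Finset (ι → ℤ)} {f : ℤ}
    (hVd : ∀ v ∈ V, v ⬝ᵥ d = 0) (hVV : ∀ v ∈ V, v ⬝ᵥ v = f + 1)
    (hVW : ∀ v ∈ V, ∀ w ∈ V, v ≠ w → v ⬝ᵥ w = f) (hV : V.Nonempty) :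
    ∃ (ε : ℤ) (g : ι → ℤ) (X : Finset ι), (ε = 1 ∨ ε = -1) ∧
      V = X.image fun x ↦ Pi.single x ε + g := by
  obtain ⟨v₀, hv₀⟩ := hV
  have h1 : ∀ v ∈ V.erase v₀, ∃ x y, x ≠ y ∧ v - v₀ = Pi.single x 1 - Pi.single y 1 := by
    intro v hv
    obtain ⟨hne, hv⟩ := Finset.mem_erase.1 hv
    refine exists_eq_single_sub_single hd ?_ ?_
    · rw [sub_dotProduct, hVd v hv, hVd v₀ hv₀, sub_zero]
    · rw [sub_dotProduct, dotProduct_sub, dotProduct_sub, hVV v hv, hVV v₀ hv₀,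
        hVW v hv v₀ hv₀ hne, hVW v₀ hv₀ v hv hne.symm]
      ring
  choose! a b hab h using h1
  have key : ∀ v ∈ V.erase v₀, ∀ w ∈ V.erase v₀, a v ≠ a w → b v = b w := by
    intro v hv w hw hne
    have hvw : v ≠ w := by rintro rfl; exact hne rfl
    have hv' := Finset.mem_erase.1 hv
    have hw' := Finset.mem_erase.1 hw
    have h2 : (v - v₀) ⬝ᵥ (w - v₀) = 1 := by
      rw [sub_dotProduct, dotProduct_sub, dotProduct_sub, hVW v hv'.2 w hw'.2 hvw,
        hVW v hv'.2 v₀ hv₀ hv'.1, hVW v₀ hv₀ w hw'.2 hw'.1.symm, hVV v₀ hv₀]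
      ring
    rw [h v hv, h w hw] at h2
    simp only [sub_dotProduct, dotProduct_sub, single_dotProduct, one_mul, Pi.single_apply] at h2
    rw [if_neg hne] at h2
    by_contra hb
    rw [if_neg hb] at h2
    split_ifs at h2 <;> omega
  have hmem : ∀ v ∈ V, v = v₀ ∨ v ∈ V.erase v₀ := fun v hv ↦
    or_iff_not_imp_left.2 fun hne ↦ Finset.mem_erase.2 ⟨hne, hv⟩
  by_cases hall : ∃ a₀, ∀ v ∈ V.erase v₀, a v = a₀
  · obtain ⟨a₀, ha⟩ := hall
    refine ⟨-1, v₀ + Pi.single a₀ 1, insert a₀ ((V.erase v₀).image b), Or.inr rfl, ?_⟩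
    have e0 : Pi.single a₀ (-1) + (v₀ + Pi.single a₀ 1) = v₀ := by
      rw [Pi.single_neg]; abel
    have e1 : ∀ v ∈ V.erase v₀, Pi.single (b v) (-1) + (v₀ + Pi.single a₀ 1) = v := fun v hv ↦ by
      rw [Pi.single_neg, ← ha v hv]
      have := h v hv
      rw [sub_eq_iff_eq_add] at this
      exact Eq.trans (by abel) this.symm
    rw [Finset.image_insert, e0, Finset.image_image]
    ext v
    rw [Finset.mem_insert, Finset.mem_image]
    constructor
    · intro hv
      exact (hmem v hv).imp_right fun hv ↦ ⟨v, hv, e1 v hv⟩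
    · rintro (rfl | ⟨w, hw, rfl⟩)
      · exact hv₀
      · rw [Function.comp, e1 w hw]; exact (Finset.mem_erase.1 hw).2
  · have hb : ∃ b₀, ∀ v ∈ V.erase v₀, b v = b₀ := by
      have hne : ∃ v ∈ V.erase v₀, True := by
        by_contra! h'
        exact hall ⟨a v₀, fun v hv ↦ (h' v hv).elim⟩
      obtain ⟨v, hv, -⟩ := hne
      obtain ⟨w, hw, hwv⟩ : ∃ w ∈ V.erase v₀, a w ≠ a v := by
        by_contra! h'
        exact hall ⟨a v, h'⟩
      refine ⟨b v, fun u hu ↦ ?_⟩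
      by_cases huv : a u = a v
      · rw [key u hu w hw (by rw [huv]; exact hwv.symm), key w hw v hv hwv]
      · exact key u hu v hv huv
    obtain ⟨b₀, hb⟩ := hb
    refine ⟨1, v₀ - Pi.single b₀ 1, insert b₀ ((V.erase v₀).image a), Or.inl rfl, ?_⟩
    have e0 : Pi.single b₀ 1 + (v₀ - Pi.single b₀ 1) = v₀ := by abel
    have e1 : ∀ v ∈ V.erase v₀, Pi.single (a v) 1 + (v₀ - Pi.single b₀ 1) = v := fun v hv ↦ by
      rw [← hb v hv]
      have := h v hv
      rw [sub_eq_iff_eq_add] at this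
      exact Eq.trans (by abel) this.symm
    rw [Finset.image_insert, e0, Finset.image_image]
    ext v
    rw [Finset.mem_insert, Finset.mem_image]
    constructor
    · intro hv
      exact (hmem v hv).imp_right fun hv ↦ ⟨v, hv, e1 v hv⟩
    · rintro (rfl | ⟨w, hw, rfl⟩)
      · exact hv₀
      · rw [Function.comp, e1 w hw]; exact (Finset.mem_erase.1 hw).2

end

/-- Bessel's inequality for integral vectors. -/
theorem sum_sq_div_le {ι κ : Type*} [Fintype ι] [Fintype κ] (e : ι → ℤ) (u : κ → ι → ℤ)
    (hu : ∀ k l, k ≠ l → u k ⬝ᵥ u l = 0) (hu0 : ∀ k, u k ⬝ᵥ u k ≠ 0) :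
    ∑ k, ((e ⬝ᵥ u k : ℤ) : ℚ) ^ 2 / (u k ⬝ᵥ u k : ℤ) ≤ (e ⬝ᵥ e : ℤ) := by
  classical
  let c : (ι → ℤ) → ι → ℚ := fun v i ↦ v i
  have hc : ∀ v w : ι → ℤ, ((v ⬝ᵥ w : ℤ) : ℚ) = c v ⬝ᵥ c w := fun v w ↦ by
    simp [c, dotProduct]
  let t : κ → ℚ := fun k ↦ (c e ⬝ᵥ c (u k)) / (c (u k) ⬝ᵥ c (u k))
  have ht : ∀ k, t k * (c (u k) ⬝ᵥ c (u k)) = c e ⬝ᵥ c (u k) := fun k ↦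
    div_mul_cancel₀ _ (by rw [← hc]; exact_mod_cast hu0 k)
  let s : ι → ℚ := ∑ k, t k • c (u k)
  have hes : c e ⬝ᵥ s = ∑ k, ((e ⬝ᵥ u k : ℤ) : ℚ) ^ 2 / (u k ⬝ᵥ u k : ℤ) := by
    simp only [s, dotProduct_sum, dotProduct_smul, t, hc, smul_eq_mul]
    exact Finset.sum_congr rfl fun k _ ↦ by ring
  have hss : s ⬝ᵥ s = c e ⬝ᵥ s := by
    have h1 : ∀ k, c (u k) ⬝ᵥ s = c e ⬝ᵥ c (u k) := fun k ↦ by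
      simp only [s, dotProduct_sum, dotProduct_smul, smul_eq_mul]
      rw [Finset.sum_eq_single k (fun l _ hl ↦ ?_) (by simp), ht]
      rw [← hc, hu k l hl.symm, Int.cast_zero, mul_zero]
    rw [show s = ∑ k, t k • c (u k) from rfl, sum_dotProduct, dotProduct_sum]
    exact Finset.sum_congr rfl fun k _ ↦ by rw [smul_dotProduct, dotProduct_smul, h1]
  have h : 0 ≤ (c e - s) ⬝ᵥ (c e - s) := Finset.sum_nonneg fun i _ ↦ mul_self_nonneg _
  rw [sub_dotProduct, dotProduct_sub, dotProduct_sub, dotProduct_comm s, hss] at h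
  rw [← hes, hc]
  linarith

section

variable {κ : Type*} [Fintype κ] [DecidableEq κ] {f w : κ → ℕ} {c : κ → κ → ℤ}

theorem sum_inv_le {j : κ} {M B : ℚ} (hM : 0 ≤ M) (hB : 0 ≤ B)
    (hdual : ∑ i ∈ Finset.univ.erase j, (w i * c j i ^ 2 : ℚ) ≤ f j - 1)
    (hbessel : ∑ i ∈ Finset.univ.erase j, (w i * c i j ^ 2 / (w i * f i + 1) : ℚ) ≤
      f j / (w j * f j + 1))
    (h : ∀ i ≠ j, (f i : ℚ)⁻¹ ≤ M * (w i * c i j ^ 2 / (w i * f i + 1)) + B * (w i * c j i ^ 2)) :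
    ∑ i, (f i : ℚ)⁻¹ ≤ (f j : ℚ)⁻¹ + (M * (f j / (w j * f j + 1)) + B * (f j - 1)) := by
  rw [← Finset.add_sum_erase _ _ (Finset.mem_univ j)]
  gcongr
  calc _ ≤ ∑ i ∈ Finset.univ.erase j,
        (M * (w i * c i j ^ 2 / (w i * f i + 1)) + B * (w i * c j i ^ 2) : ℚ) :=
        Finset.sum_le_sum fun i hi ↦ h i (Finset.ne_of_mem_erase hi)
    _ ≤ _ := by
      rw [Finset.sum_add_distrib, ← Finset.mul_sum, ← Finset.mul_sum]
      gcongr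

theorem inv_le_of_left_ne_zero {a : ℤ} {x y m : ℕ} {M : ℚ} (ha : a ≠ 0) (hx : 0 < x) (hy : 0 < y)
    (hm : 0 < m) (hmxy : m ≤ x * y) (hM : ((m : ℚ) + 1) / m ≤ M) :
    (x : ℚ)⁻¹ ≤ M * (y * a ^ 2 / (y * x + 1)) := by
  have hx' : (0 : ℚ) < x := by exact_mod_cast hx
  have hy' : (0 : ℚ) < y := by exact_mod_cast hy
  have hm' : (0 : ℚ) < m := by exact_mod_cast hm
  have h : (m : ℚ) ≤ x * y := by exact_mod_cast hmxy
  have ha' : (1 : ℚ) ≤ (a : ℚ) ^ 2 := by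
    have : 1 ≤ a ^ 2 := by have := sq_pos_of_ne_zero ha; omega
    exact_mod_cast this
  have h1 : (y : ℚ) / (y * x + 1) ≤ y * a ^ 2 / (y * x + 1) := by
    gcongr
    nlinarith
  have h2 : (x : ℚ)⁻¹ ≤ (m + 1) / m * (y / (y * x + 1)) := by
    rw [div_mul_div_comm, inv_eq_one_div, div_le_div_iff₀ (by positivity) (by positivity)]
    nlinarith
  calc _ ≤ _ := h2
    _ ≤ M * (y / (y * x + 1)) := by gcongr
    _ ≤ _ := by
      gcongr
      exact le_trans (by positivity) hM

theorem inv_le_of_right_ne_zero {a : ℤ} {x y : ℕ} {B : ℚ} (ha : a ≠ 0) (hB : 0 ≤ B)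
    (h : (x : ℚ)⁻¹ ≤ B * y) : (x : ℚ)⁻¹ ≤ B * (y * a ^ 2) := by
  have ha' : (1 : ℚ) ≤ (a : ℚ) ^ 2 := by
    have : 1 ≤ a ^ 2 := by have := sq_pos_of_ne_zero ha; omega
    exact_mod_cast this
  refine h.trans ?_
  gcongr
  exact le_mul_of_one_le_right (by positivity) ha'

/-- The numerical contradiction: the constraints satisfied by the Sylow normalizer indices `f`
and the numbers `w` of exceptional characters force `∑ 1 / f` to be at most one. -/
theorem sum_inv_le_one (hf : ∀ k, 3 ≤ f k) (hfo : ∀ k, Odd (f k)) (hw : ∀ k, 2 ≤ w k)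
    (hwe : ∀ k, Even (w k)) (hα : Function.Injective fun k ↦ w k * f k)
    (hne : ∀ k l, k ≠ l → c k l ≠ 0 ∨ c l k ≠ 0)
    (hdual : ∀ j, ∑ i ∈ Finset.univ.erase j, (w i * c j i ^ 2 : ℚ) ≤ f j - 1)
    (hbessel : ∀ j, ∑ i ∈ Finset.univ.erase j, (w i * c i j ^ 2 / (w i * f i + 1) : ℚ) ≤
      f j / (w j * f j + 1)) : ∑ i, (f i : ℚ)⁻¹ ≤ 1 := by
  cases isEmpty_or_nonempty κ
  · simp
  have hl : ∀ {i j M B}, 0 ≤ B → (f i : ℚ)⁻¹ ≤ M * (w i * c i j ^ 2 / (w i * f i + 1)) →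
      (f i : ℚ)⁻¹ ≤ M * (w i * c i j ^ 2 / (w i * f i + 1)) + B * (w i * c j i ^ 2) :=
    fun hB h ↦ h.trans (le_add_of_nonneg_right (by positivity))
  have hr : ∀ {i j M B}, 0 ≤ M → (f i : ℚ)⁻¹ ≤ B * (w i * c j i ^ 2) →
      (f i : ℚ)⁻¹ ≤ M * (w i * c i j ^ 2 / (w i * f i + 1)) + B * (w i * c j i ^ 2) :=
    fun hM h ↦ h.trans (le_add_of_nonneg_left (by positivity))
  have hw4 : ∀ k, w k ≠ 2 → 4 ≤ w k := fun k hk ↦ by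
    have := hw k; obtain ⟨r, hr⟩ := hwe k; omega
  have hf2 : ∀ k l, f k ≤ f l → f k ≠ f l → f k + 2 ≤ f l := fun k l h h' ↦ by
    obtain ⟨r, hr⟩ := hfo k; obtain ⟨s, hs⟩ := hfo l; omega
  by_cases hcase : ∃ j, (∀ i, f j ≤ f i) ∧ (5 ≤ f j ∨ 4 ≤ w j)
  · obtain ⟨j, hmin, hj⟩ := hcase
    have hfj : (3 : ℚ) ≤ f j := by exact_mod_cast hf j
    have hM0 : (0 : ℚ) ≤ ((2 * f j : ℕ) + 1) / (2 * f j : ℕ) := by positivity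
    have hS : ∀ i, c i j ≠ 0 → (f i : ℚ)⁻¹ ≤ (((2 * f j : ℕ) + 1) / (2 * f j : ℕ) : ℚ) *
        (w i * c i j ^ 2 / (w i * f i + 1)) := fun i hi ↦ by
      refine inv_le_of_left_ne_zero hi (by linarith [hf i]) (by linarith [hw i])
        (by linarith [hf j]) ?_ le_rfl
      nlinarith [hmin i, hw i]
    by_cases hwj : w j = 2
    · have hf5 : (5 : ℚ) ≤ f j := by exact_mod_cast hj.resolve_right (by omega)
      refine (sum_inv_le (B := 1 / (2 * (f j + 2))) hM0 (by positivity) (hdual j) (hbessel j)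
        fun i hij ↦ ?_).trans ?_
      · rcases hne i j hij with h | h
        · exact hl (by positivity) (hS i h)
        · refine hr hM0 (inv_le_of_right_ne_zero h (by positivity) ?_)
          have hfi : (f j : ℚ) ≤ f i := by exact_mod_cast hmin i
          rw [div_mul_eq_mul_div, one_mul, inv_eq_one_div, div_le_div_iff₀ (by linarith)
            (by positivity)]
          by_cases hwi : w i = 2
          · have : f j + 2 ≤ f i := hf2 j i (hmin i) fun h ↦ hij (hα (by simp [hwi, hwj, h]))
            have : (f j : ℚ) + 2 ≤ f i := by exact_mod_cast this
            rw [hwi]; push_cast; linarith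
          · have : (4 : ℚ) ≤ w i := by exact_mod_cast hw4 i hwi
            nlinarith
      · rw [hwj]; push_cast
        have h1 : (f j : ℚ)⁻¹ + ((2 * f j + 1) / (2 * f j) * (f j / (2 * f j + 1)) +
          1 / (2 * (f j + 2)) * (f j - 1)) = 1 - (f j - 4) / (2 * f j * (f j + 2)) := by
          have : (f j : ℚ) ≠ 0 := by positivity
          field_simp; ring
        rw [h1]
        have : 0 ≤ ((f j : ℚ) - 4) / (2 * f j * (f j + 2)) :=
          div_nonneg (by linarith) (by positivity)
        linarith
    · have hw4' : (4 : ℚ) ≤ w j := by exact_mod_cast hw4 j hwj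
      refine (sum_inv_le (B := 1 / (2 * f j)) hM0 (by positivity) (hdual j) (hbessel j)
        fun i hij ↦ ?_).trans ?_
      · rcases hne i j hij with h | h
        · exact hl (by positivity) (hS i h)
        · refine hr hM0 (inv_le_of_right_ne_zero h (by positivity) ?_)
          have hfi : (f j : ℚ) ≤ f i := by exact_mod_cast hmin i
          have hwi : (2 : ℚ) ≤ w i := by exact_mod_cast hw i
          rw [div_mul_eq_mul_div, one_mul, inv_eq_one_div, div_le_div_iff₀ (by linarith)
            (by positivity)]
          nlinarith
      · have h0 : (0 : ℚ) < f j := by linarith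
        have h1 : (f j : ℚ) / (w j * f j + 1) ≤ f j / (4 * f j + 1) := by gcongr
        have h2 : (f j : ℚ)⁻¹ + (((2 * f j : ℕ) + 1) / (2 * f j : ℕ) * (f j / (4 * f j + 1)) +
          1 / (2 * f j) * (f j - 1)) =
            1 - (2 * f j ^ 2 - 4 * f j - 1) / (2 * f j * (4 * f j + 1)) := by
          push_cast
          field_simp; ring
        have h3 : 0 ≤ (2 * (f j : ℚ) ^ 2 - 4 * f j - 1) / (2 * f j * (4 * f j + 1)) :=
          div_nonneg (by nlinarith) (by positivity)
        calc _ ≤ (f j : ℚ)⁻¹ + (((2 * f j : ℕ) + 1) / (2 * f j : ℕ) * (f j / (4 * f j + 1)) +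
          1 / (2 * f j) * (f j - 1)) := by gcongr
          _ ≤ 1 := by rw [h2]; linarith
  · push Not at hcase
    obtain ⟨j, hmin⟩ := Finite.exists_min f
    have hj := hcase j hmin
    have hfj : f j = 3 := by
      have := hf j; obtain ⟨r, hr⟩ := hfo j; omega
    have hwj : w j = 2 := by
      by_contra h; have := hw4 j h; omega
    have hf5 : ∀ i ≠ j, 5 ≤ f i := fun i hij ↦ by
      have h : f j ≠ f i := fun h ↦ by
        have hi := hcase i fun k ↦ h ▸ hmin k
        have hwi : w i = 2 := by by_contra h; have := hw4 i h; omega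
        exact hij (hα (by simp [hwi, hwj, h]))
      have := hf2 j i (hmin i) h
      omega
    have hw2 : ∀ i ≠ j, c j i ≠ 0 → w i = 2 := fun i hij h ↦ by
      have h1 := Finset.single_le_sum (f := fun i ↦ (w i * c j i ^ 2 : ℚ))
        (fun i _ ↦ by positivity) (Finset.mem_erase.2 ⟨hij, Finset.mem_univ i⟩)
      have h2 := h1.trans (hdual j)
      have ha' : (1 : ℚ) ≤ (c j i : ℚ) ^ 2 := by
        have : 1 ≤ c j i ^ 2 := by have := sq_pos_of_ne_zero h; omega
        exact_mod_cast this
      rw [hfj] at h2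
      by_contra hwi
      have : (4 : ℚ) ≤ w i := by exact_mod_cast hw4 i hwi
      push_cast at h2
      nlinarith
    by_cases hu : ∃ u ≠ j, c j u ≠ 0 ∧ f u = 5
    · obtain ⟨u, huj, hcu, hfu⟩ := hu
      have hwu := hw2 u huj hcu
      refine (sum_inv_le (M := 15 / 14) (B := 1 / 10) (by norm_num) (by norm_num) (hdual j)
        (hbessel j) fun i hij ↦ ?_).trans (by rw [hfj, hwj]; norm_num)
      by_cases h : c j i ≠ 0
      · refine hr (by norm_num) (inv_le_of_right_ne_zero h (by norm_num) ?_)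
        have h5 : (5 : ℚ) ≤ f i := by exact_mod_cast hf5 i hij
        rw [hw2 i hij h]
        have := inv_anti₀ (by norm_num) h5
        norm_num at this ⊢
        linarith
      · refine hl (by norm_num) (inv_le_of_left_ne_zero ((hne i j hij).resolve_right h)
          (by linarith [hf i]) (by linarith [hw i]) (by norm_num : 0 < 14) ?_ (by norm_num))
        have h5 := hf5 i hij
        by_cases hfi : f i = 5
        · have : w i ≠ 2 := fun hwi ↦ h ((hα (by simp [hwi, hwu, hfi, hfu]) : i = u) ▸ hcu)
          have := hw4 i this
          nlinarith
        · have : 7 ≤ f i := by obtain ⟨r, hr⟩ := hfo i; omega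
          nlinarith [hw i]
    · push Not at hu
      refine (sum_inv_le (M := 11 / 10) (B := 1 / 14) (by norm_num) (by norm_num) (hdual j)
        (hbessel j) fun i hij ↦ ?_).trans (by rw [hfj, hwj]; norm_num)
      have h5 := hf5 i hij
      rcases hne i j hij with h | h
      · refine hl (by norm_num) (inv_le_of_left_ne_zero h
          (by linarith [hf i]) (by linarith [hw i]) (by norm_num : 0 < 10) ?_ (by norm_num))
        nlinarith [hw i]
      · refine hr (by norm_num) (inv_le_of_right_ne_zero h (by norm_num) ?_)
        have : 7 ≤ f i := by have := hu i hij h; obtain ⟨r, hr⟩ := hfo i; omega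
        have h7 : (7 : ℚ) ≤ f i := by exact_mod_cast this
        rw [hw2 i hij h]
        have := inv_anti₀ (by norm_num) h7
        norm_num at this ⊢
        linarith

end

/-- A family of mutually orthogonal coherent sets of integral vectors, compatible with an
involution `σ` of the coordinates which has a single fixed point. -/
structure CoherentFamily (ι κ : Type*) [Fintype ι] [DecidableEq ι] where
  /-- The involution of the coordinates. -/
  σ : ι → ι
  /-- The fixed point of `σ`. -/
  i₀ : ι
  /-- The sign of each set. -/
  ε : κ → ℤ
  /-- The vector by which each set is translated. -/
  g : κ → ι → ℤ
  /-- The coordinates of the unit vectors defining each set. -/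
  X : κ → Finset ι
  /-- The scalar product of distinct vectors of a set. -/
  f : κ → ℕ
  σ_σ (i : ι) : σ (σ i) = i
  σ_i₀ : σ i₀ = i₀
  eq_i₀ (i : ι) : σ i = i → i = i₀
  ε_eq (k : κ) : ε k = 1 ∨ ε k = -1
  two_le (k : κ) : 2 ≤ (X k).card
  apply_i₀ (k : κ) (x : ι) : x ∈ X k → (Pi.single x (ε k) : ι → ℤ) i₀ + g k i₀ = -1
  conj (k : κ) (x : ι) : x ∈ X k →
    ∃ y ∈ X k, (Pi.single x (ε k) + g k : ι → ℤ) ∘ σ = (Pi.single y (ε k) + g k : ι → ℤ)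
  self (k : κ) (x : ι) : x ∈ X k →
    (Pi.single x (ε k) + g k : ι → ℤ) ⬝ᵥ (Pi.single x (ε k) + g k : ι → ℤ) = f k + 1
  pair (k : κ) (x y : ι) : x ∈ X k → y ∈ X k → x ≠ y →
    (Pi.single x (ε k) + g k : ι → ℤ) ⬝ᵥ (Pi.single y (ε k) + g k : ι → ℤ) = f k
  orth (k l : κ) (x y : ι) : k ≠ l → x ∈ X k → y ∈ X l →
    (Pi.single x (ε k) + g k : ι → ℤ) ⬝ᵥ (Pi.single y (ε l) + g l : ι → ℤ) = 0

namespace CoherentFamily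

section

variable {ι κ : Type*} [Fintype ι] [DecidableEq ι] (F : CoherentFamily ι κ)

theorem ε_mul_self (k : κ) : F.ε k * F.ε k = 1 := by
  rcases F.ε_eq k with h | h <;> simp [h]

theorem ε_ne_zero (k : κ) : F.ε k ≠ 0 := by
  rcases F.ε_eq k with h | h <;> simp [h]

theorem exists_ne {k : κ} (x : ι) : ∃ y ∈ F.X k, y ≠ x :=
  Finset.exists_mem_ne (F.two_le k) x

theorem nonempty (k : κ) : (F.X k).Nonempty :=
  Finset.card_pos.1 (by have := F.two_le k; omega)

theorem single_add_dotProduct (k l : κ) (x y : ι) :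
    (Pi.single x (F.ε k) + F.g k) ⬝ᵥ (Pi.single y (F.ε l) + F.g l) =
      (if x = y then F.ε k * F.ε l else 0) + F.ε k * F.g l x + F.ε l * F.g k y +
        F.g k ⬝ᵥ F.g l := by
  simp only [add_dotProduct, dotProduct_add, single_dotProduct, dotProduct_single, Pi.add_apply,
    Pi.single_apply, eq_comm (a := y)]
  split_ifs <;> ring

theorem disjoint {k l : κ} (hkl : k ≠ l) : Disjoint (F.X k) (F.X l) := by
  rw [Finset.disjoint_left]
  intro z hk hl
  obtain ⟨x, hx, hxz⟩ := F.exists_ne (k := k) z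
  obtain ⟨y, hy, hyz⟩ := F.exists_ne (k := l) z
  have h1 := F.orth k l z z hkl hk hl
  have h2 := F.orth k l x z hkl hx hl
  have h3 := F.orth k l z y hkl hk hy
  have h4 := F.orth k l x y hkl hx hy
  rw [single_add_dotProduct] at h1 h2 h3 h4
  rw [if_pos rfl] at h1
  rw [if_neg hxz] at h2
  rw [if_neg hyz.symm] at h3
  rcases F.ε_eq k with h | h <;> rcases F.ε_eq l with h' | h' <;> rw [h, h'] at h1 h2 h3 h4 <;>
    split_ifs at h4 <;> linarith

/-- The constant value of `F.g k` on `F.X l`. -/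
noncomputable def c (k l : κ) : ℤ := F.g k (F.nonempty l).choose

theorem g_apply_self {k : κ} {x : ι} (hx : x ∈ F.X k) :
    2 * F.ε k * F.g k x = F.f k - F.g k ⬝ᵥ F.g k := by
  have h := F.self k x hx
  rw [single_add_dotProduct, if_pos rfl, ε_mul_self] at h
  linarith

theorem g_apply (k l : κ) {x : ι} (hx : x ∈ F.X l) : F.g k x = F.c k l := by
  have hc := (F.nonempty l).choose_spec
  rcases eq_or_ne k l with rfl | hkl
  · refine mul_left_cancel₀ (mul_ne_zero two_ne_zero (F.ε_ne_zero k)) ?_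
    rw [F.g_apply_self hx, c, F.g_apply_self hc]
  · obtain ⟨y, hy⟩ := F.nonempty k
    have h1 := F.orth k l y x hkl hy hx
    have h2 := F.orth k l y _ hkl hy hc
    have hne : ∀ z ∈ F.X l, y ≠ z := fun z hz h ↦
      Finset.disjoint_left.1 (F.disjoint hkl) hy (h ▸ hz)
    rw [single_add_dotProduct, if_neg (hne _ hx)] at h1
    rw [single_add_dotProduct, if_neg (hne _ hc)] at h2
    exact mul_left_cancel₀ (F.ε_ne_zero l) (by rw [c]; linarith)

theorem i₀_notMem (k : κ) : F.i₀ ∉ F.X k := by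
  intro h
  obtain ⟨y, hy, hne⟩ := F.exists_ne (k := k) F.i₀
  have h1 := F.apply_i₀ k _ h
  have h2 := F.apply_i₀ k _ hy
  rw [Pi.single_eq_same] at h1
  rw [Pi.single_eq_of_ne hne.symm] at h2
  exact F.ε_ne_zero k (by linarith)

theorem g_i₀ (k : κ) : F.g k F.i₀ = -1 := by
  obtain ⟨y, hy⟩ := F.nonempty k
  have h := F.apply_i₀ k _ hy
  have hne : F.i₀ ≠ y := fun h ↦ F.i₀_notMem k (h ▸ hy)
  rwa [Pi.single_eq_of_ne hne, zero_add] at h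

theorem g_σ (k : κ) (i : ι) : F.g k (F.σ i) = F.g k i := by
  obtain ⟨x, hx⟩ := F.nonempty k
  obtain ⟨x', hx', hne⟩ := F.exists_ne (k := k) x
  obtain ⟨y, -, h⟩ := F.conj k x hx
  obtain ⟨y', -, h'⟩ := F.conj k x' hx'
  have hyy : y ≠ y' := by
    rintro rfl
    have h1 := congrFun (h.trans h'.symm) (F.σ x)
    simp only [Function.comp, F.σ_σ, Pi.add_apply, Pi.single_eq_same,
      Pi.single_eq_of_ne hne.symm] at h1
    exact F.ε_ne_zero k (by linarith)
  have h1 := congrFun h i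
  have h2 := congrFun h' i
  simp only [Function.comp, Pi.add_apply, Pi.single_apply] at h1 h2
  have := F.ε_ne_zero k
  split_ifs at h1 h2 <;> first | omega | (exfalso; simp_all)

theorem dotProduct_g_ne_zero (k l : κ) : F.g k ⬝ᵥ F.g l ≠ 0 := by
  intro h
  have h1 : ((F.g k ⬝ᵥ F.g l : ℤ) : ZMod 2) = 1 := by
    rw [dotProduct, ← Finset.add_sum_erase _ _ (Finset.mem_univ F.i₀), g_i₀, g_i₀, Int.cast_add,
      Int.cast_sum]
    have : ∑ i ∈ Finset.univ.erase F.i₀, ((F.g k i * F.g l i : ℤ) : ZMod 2) = 0 := by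
      refine Finset.sum_involution (fun i _ ↦ F.σ i) ?_ ?_ ?_ ?_
      · intro i _
        rw [g_σ, g_σ]
        exact CharTwo.add_self_eq_zero _
      · intro i hi _ h
        exact Finset.ne_of_mem_erase hi (F.eq_i₀ i h)
      · intro i hi
        refine Finset.mem_erase.2 ⟨fun h ↦ Finset.ne_of_mem_erase hi ?_, Finset.mem_univ _⟩
        rw [← F.σ_σ i, h, F.σ_i₀]
      · intro i _
        exact F.σ_σ i
    rw [this]
    simp
  rw [h] at h1
  simp at h1

theorem c_ne_zero_or (k l : κ) (hkl : k ≠ l) : F.c k l ≠ 0 ∨ F.c l k ≠ 0 := by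
  by_contra! h
  obtain ⟨x, hx⟩ := F.nonempty k
  obtain ⟨y, hy⟩ := F.nonempty l
  have h1 := F.orth k l x y hkl hx hy
  have hne : x ≠ y := fun e ↦ Finset.disjoint_left.1 (F.disjoint hkl) hx (e ▸ hy)
  rw [single_add_dotProduct, F.g_apply l k hx, F.g_apply k l hy, h.1, h.2, if_neg hne] at h1
  exact F.dotProduct_g_ne_zero k l (by linarith)

theorem sum_card_mul_sq_le [Fintype κ] [DecidableEq κ] (j : κ) :
    ∑ i ∈ Finset.univ.erase j, ((F.X i).card * F.c j i ^ 2 : ℚ) ≤ F.f j - 1 := by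
  have h1 : 1 + ∑ l, ((F.X l).card : ℤ) * F.c j l ^ 2 ≤ F.g j ⬝ᵥ F.g j := by
    rw [dotProduct, ← Finset.add_sum_erase _ _ (Finset.mem_univ F.i₀), g_i₀]
    refine add_le_add (by norm_num) ?_
    calc _ = ∑ i ∈ Finset.univ.biUnion F.X, F.g j i * F.g j i := by
          rw [Finset.sum_biUnion fun k _ l _ hkl ↦ F.disjoint hkl]
          refine Finset.sum_congr rfl fun l _ ↦ ?_
          rw [Finset.sum_congr rfl fun i hi ↦ by rw [F.g_apply j l hi], Finset.sum_const,
            nsmul_eq_mul, sq]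
      _ ≤ _ := by
          refine Finset.sum_le_sum_of_subset_of_nonneg (fun i hi ↦ ?_)
            fun i _ _ ↦ mul_self_nonneg _
          obtain ⟨l, -, hl⟩ := Finset.mem_biUnion.1 hi
          exact Finset.mem_erase.2 ⟨fun h ↦ F.i₀_notMem l (h ▸ hl), Finset.mem_univ _⟩
  obtain ⟨x, hx⟩ := F.nonempty j
  have h2 := F.g_apply_self hx
  rw [F.g_apply j j hx] at h2
  rw [← Finset.add_sum_erase _ _ (Finset.mem_univ j)] at h1
  have h3 : (2 : ℤ) ≤ (F.X j).card := by exact_mod_cast F.two_le j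
  have h4 : 0 ≤ ((F.X j).card : ℤ) * F.c j j ^ 2 + 2 * F.ε j * F.c j j := by
    have h5 : 0 ≤ F.c j j ^ 2 + F.ε j * F.c j j := by
      rcases F.ε_eq j with h | h <;> rw [h]
      · rcases le_or_gt 0 (F.c j j) with h' | h' <;> nlinarith
      · rcases le_or_gt (F.c j j) 0 with h' | h' <;> nlinarith
    nlinarith [sq_nonneg (F.c j j)]
  have h6 : ∑ i ∈ Finset.univ.erase j, ((F.X i).card : ℤ) * F.c j i ^ 2 ≤ F.f j - 1 := by linarith
  exact_mod_cast h6

/-- The sum of the vectors of one of the sets. -/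
def total (k : κ) : ι → ℤ := ∑ x ∈ F.X k, (Pi.single x (F.ε k) + F.g k)

theorem total_dotProduct_self (k : κ) :
    F.total k ⬝ᵥ F.total k = (F.X k).card * ((F.X k).card * F.f k + 1) := by
  rw [total, sum_dotProduct]
  simp_rw [dotProduct_sum]
  rw [Finset.sum_congr rfl (g := fun _ ↦ ((F.X k).card * F.f k + 1 : ℤ)) fun x hx ↦ ?_,
    Finset.sum_const, nsmul_eq_mul]
  rw [Finset.sum_congr rfl (g := fun y ↦ (F.f k : ℤ) + if x = y then 1 else 0) fun y hy ↦ ?_]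
  · rw [Finset.sum_add_distrib, Finset.sum_const, nsmul_eq_mul, Finset.sum_ite_eq, if_pos hx]
  · split_ifs with h
    · subst h; exact F.self k x hx
    · rw [F.pair k x y hx hy h, add_zero]

theorem total_dotProduct_of_ne {k l : κ} (hkl : k ≠ l) : F.total k ⬝ᵥ F.total l = 0 := by
  rw [total, total, sum_dotProduct]
  refine Finset.sum_eq_zero fun x hx ↦ ?_
  rw [dotProduct_sum]
  exact Finset.sum_eq_zero fun y hy ↦ F.orth k l x y hkl hx hy

/-- The indicator vector of one of the sets of coordinates. -/
def indicator (j : κ) : ι → ℤ := fun i ↦ if i ∈ F.X j then 1 else 0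

theorem indicator_dotProduct (j : κ) (v : ι → ℤ) : F.indicator j ⬝ᵥ v = ∑ y ∈ F.X j, v y := by
  simp [indicator, dotProduct, ite_mul, Finset.sum_ite_mem]

theorem indicator_dotProduct_total [DecidableEq κ] (j k : κ) : F.indicator j ⬝ᵥ F.total k =
    (F.X k).card * ((if j = k then F.ε k else 0) + (F.X j).card * F.c k j) := by
  rw [total, dotProduct_sum, Finset.sum_congr rfl (g := fun _ ↦
    (if j = k then F.ε k else 0) + ((F.X j).card * F.c k j : ℤ)) fun x hx ↦ ?_,
    Finset.sum_const, nsmul_eq_mul]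
  rw [indicator_dotProduct]
  simp only [Pi.add_apply, Finset.sum_add_distrib]
  congr 1
  · rw [Finset.sum_congr rfl fun y _ ↦ Pi.single_apply x (F.ε k) y, Finset.sum_ite_eq']
    rcases eq_or_ne j k with rfl | hjk
    · simp [hx]
    · rw [if_neg hjk, if_neg (Finset.disjoint_right.1 (F.disjoint hjk) hx)]
  · rw [Finset.sum_congr rfl fun y hy ↦ F.g_apply k j hy, Finset.sum_const, nsmul_eq_mul]

theorem sum_div_le [Fintype κ] [DecidableEq κ] (j : κ) :
    ∑ i ∈ Finset.univ.erase j, ((F.X i).card * F.c i j ^ 2 / ((F.X i).card * F.f i + 1) : ℚ) ≤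
      F.f j / ((F.X j).card * F.f j + 1) := by
  have hw : ∀ k, (2 : ℚ) ≤ (F.X k).card := fun k ↦ by exact_mod_cast F.two_le k
  have hbessel := sum_sq_div_le (F.indicator j) F.total (fun k l ↦ F.total_dotProduct_of_ne)
    fun k ↦ by
      rw [total_dotProduct_self]
      have := F.two_le k
      positivity
  have hE : F.indicator j ⬝ᵥ F.indicator j = (F.X j).card := by
    rw [indicator_dotProduct]
    simp +contextual [indicator]
  rw [hE, ← Finset.add_sum_erase _ _ (Finset.mem_univ j)] at hbessel
  have h1 : ((F.X j).card : ℚ) / ((F.X j).card * F.f j + 1) ≤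
      ((F.indicator j ⬝ᵥ F.total j : ℤ) : ℚ) ^ 2 / (F.total j ⬝ᵥ F.total j : ℤ) := by
    rw [indicator_dotProduct_total, total_dotProduct_self, if_pos rfl]
    have h2 : F.ε j + (F.X j).card * F.c j j ≠ 0 := by
      intro h
      have h3 : (((F.X j).card : ℤ)) ∣ 1 := by
        refine ⟨- F.ε j * F.c j j, ?_⟩
        have := F.ε_mul_self j
        linear_combination F.ε j * h - this
      have h4 := Int.le_of_dvd one_pos h3
      have h5 := F.two_le j
      omega
    have h3 : (1 : ℚ) ≤ (F.ε j + (F.X j).card * F.c j j : ℤ) ^ 2 := by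
      have := sq_pos_of_ne_zero h2
      exact_mod_cast this
    have h4 := hw j
    push_cast at h3 ⊢
    rw [div_le_div_iff₀ (by positivity) (by positivity), mul_pow]
    have h5 : (0 : ℚ) ≤ (F.X j).card ^ 2 * ((F.X j).card * F.f j + 1) := by positivity
    nlinarith
  have h2 : ∑ i ∈ Finset.univ.erase j,
      ((F.indicator j ⬝ᵥ F.total i : ℤ) : ℚ) ^ 2 / (F.total i ⬝ᵥ F.total i : ℤ) =
      (F.X j).card ^ 2 * ∑ i ∈ Finset.univ.erase j,
        ((F.X i).card * F.c i j ^ 2 / ((F.X i).card * F.f i + 1) : ℚ) := by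
    rw [Finset.mul_sum]
    refine Finset.sum_congr rfl fun i hi ↦ ?_
    rw [indicator_dotProduct_total, total_dotProduct_self,
      if_neg (Finset.ne_of_mem_erase hi).symm]
    have := hw i
    push_cast
    field_simp
    ring
  rw [h2] at hbessel
  have h3 := hw j
  have h4 : ((F.X j).card : ℚ) - (F.X j).card / ((F.X j).card * F.f j + 1) =
      (F.X j).card ^ 2 * (F.f j / ((F.X j).card * F.f j + 1)) := by
    field_simp
    ring
  refine le_of_mul_le_mul_left (a := ((F.X j).card : ℚ) ^ 2) ?_ (by positivity)
  rw [← h4]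
  have h5 : (((F.X j).card : ℤ) : ℚ) = (F.X j).card := by simp
  rw [h5] at hbessel
  linarith

end

end CoherentFamily

namespace MinimalCounterexample

section

variable {G : Type*} [Group G] [Finite G]

theorem odd_sylowIndex (hG : MinimalCounterexample G) (p : ℕ) : Odd (sylowIndex G p) := by
  rw [← Nat.not_even_iff_odd, even_iff_two_dvd]
  intro h
  refine hG.not_two_dvd_card (h.trans (dvd_trans ?_
    (card_subgroup_dvd_card (normalizer (sylowOf G p : Set G)))))
  exact Dvd.intro_left _ (card_normalizer_sylowOf p).symm

theorem three_le_sylowIndex (hG : MinimalCounterexample G) {p : ℕ} (hp : p.Prime)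
    (hpG : p ∣ Nat.card G) : 3 ≤ sylowIndex G p := by
  have := hG.two_le_sylowIndex hp hpG
  obtain ⟨k, hk⟩ := hG.odd_sylowIndex p
  omega

theorem exists_card_diffs (hG : MinimalCounterexample G) (T : CharacterTable G) {p : ℕ}
    (hp : p.Prime) (hpG : p ∣ Nat.card G) :
    ∃ k ≠ 0, (diffs T p).card * sylowIndex G p + 1 = p ^ k := by
  have := Fact.mk hp
  have := (nontrivial_iff_ne_bot _).2 (sylow_ne_bot hpG (sylowOf G p))
  rw [← hG.natCard_linearCharacters_sylowOf T]
  exact exists_natCard_linearCharacters_eq (sylowOf G p).isPGroup'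

theorem even_card_diffs (hG : MinimalCounterexample G) (T : CharacterTable G) {p : ℕ}
    (hp : p.Prime) (hpG : p ∣ Nat.card G) : Even (diffs T p).card := by
  obtain ⟨k, -, h⟩ := hG.exists_card_diffs T hp hpG
  have hodd : Odd (p ^ k) := (hp.odd_of_ne_two fun h ↦ hG.not_two_dvd_card (h ▸ hpG)).pow
  rw [← h, Nat.odd_add_one, Nat.not_odd_iff_even, Nat.even_mul] at hodd
  exact hodd.resolve_right (Nat.not_even_iff_odd.2 (hG.odd_sylowIndex p))

theorem two_le_card_diffs (hG : MinimalCounterexample G) (T : CharacterTable G) {p : ℕ}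
    (hp : p.Prime) (hpG : p ∣ Nat.card G) : 2 ≤ (diffs T p).card := by
  obtain ⟨k, hk, h⟩ := hG.exists_card_diffs T hp hpG
  obtain ⟨r, hr⟩ := hG.even_card_diffs T hp hpG
  have h0 : (diffs T p).card ≠ 0 := fun h0 ↦ by
    rw [h0, zero_mul, zero_add] at h
    exact (Nat.one_lt_pow hk hp.one_lt).ne h
  omega

theorem dotProduct_degree_eq_zero {T : CharacterTable G} {d : Fin T.size → ℤ}
    (hd : ∀ i, T.χ i 1 = d i) {p : ℕ} {v : Fin T.size → ℤ} (hv : v ∈ diffs T p) :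
    v ⬝ᵥ d = 0 := by
  obtain ⟨μ, -, rfl⟩ := mem_diffs.1 hv
  have h := T.sum_inducedDiff_mul_χ_one μ
  simp_rw [hd] at h
  exact_mod_cast h

theorem exists_coherentFamily (hG : MinimalCounterexample G) (T : CharacterTable G) :
    ∃ F : CoherentFamily (Fin T.size) (Nat.card G).primeFactors,
      (∀ p, F.f p = sylowIndex G p) ∧ ∀ p, (F.X p).card = (diffs T p).card := by
  have hp : ∀ p : (Nat.card G).primeFactors, (p : ℕ).Prime := fun p ↦
    Nat.prime_of_mem_primeFactors p.2
  have hpG : ∀ p : (Nat.card G).primeFactors, (p : ℕ) ∣ Nat.card G := fun p ↦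
    Nat.dvd_of_mem_primeFactors p.2
  have := fun p ↦ Fact.mk (hp p)
  choose d hd0 hd using T.exists_degree
  have hne : Nonempty (Fin T.size) := ⟨T.trivialIndex⟩
  have h1 : ∀ p : (Nat.card G).primeFactors, ∃ (ε : ℤ) (g : Fin T.size → ℤ)
      (X : Finset (Fin T.size)), (ε = 1 ∨ ε = -1) ∧
        diffs T p = X.image fun x ↦ Pi.single x ε + g := fun p ↦
    exists_coherent (d := fun i ↦ (d i : ℤ)) (fun i ↦ by exact_mod_cast hd0 i)
      (fun v hv ↦ dotProduct_degree_eq_zero (fun i ↦ by simp [hd]) hv)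
      (fun v hv ↦ hG.dotProduct_self_of_mem_diffs hv)
      (fun v hv w hw hvw ↦ hG.dotProduct_of_mem_diffs hv hw hvw)
      (Finset.card_pos.1 (by have := hG.two_le_card_diffs T (hp p) (hpG p); omega))
  choose ε g X hε hX using h1
  have hε0 : ∀ p, ε p ≠ 0 := fun p ↦ by rcases hε p with h | h <;> simp [h]
  have hinj : ∀ p, Function.Injective fun x ↦ (Pi.single x (ε p) + g p : Fin T.size → ℤ) :=
    fun p x y h ↦ by
      have h' : (Pi.single x (ε p) : Fin T.size → ℤ) = Pi.single y (ε p) := add_right_cancel h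
      by_contra hxy
      have := congrFun h' x
      rw [Pi.single_eq_same, Pi.single_eq_of_ne hxy] at this
      exact hε0 p this
  have hcard : ∀ p, (X p).card = (diffs T p).card := fun p ↦ by
    rw [hX, Finset.card_image_of_injective _ (hinj p)]
  have hmem : ∀ p, ∀ x ∈ X p, (Pi.single x (ε p) + g p : Fin T.size → ℤ) ∈ diffs T p :=
    fun p x hx ↦ by
      rw [hX]
      exact Finset.mem_image_of_mem (fun x ↦ (Pi.single x (ε p) + g p : Fin T.size → ℤ)) hx
  exact ⟨{
    σ := T.conj
    i₀ := T.trivialIndex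
    ε := ε
    g := g
    X := X
    f := fun p ↦ sylowIndex G p
    σ_σ := T.conj_conj
    σ_i₀ := T.conj_trivialIndex
    eq_i₀ := T.eq_trivialIndex hG.not_two_dvd_card
    ε_eq := hε
    two_le := fun p ↦ (hG.two_le_card_diffs T (hp p) (hpG p)).trans_eq (hcard p).symm
    apply_i₀ := fun p x hx ↦ apply_trivialIndex_of_mem_diffs (hmem p x hx)
    conj := fun p x hx ↦ by
      have h := comp_conj_mem_diffs (hmem p x hx)
      rw [hX] at h
      obtain ⟨y, hy, h⟩ := Finset.mem_image.1 h
      exact ⟨y, hy, h.symm⟩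
    self := fun p x hx ↦ hG.dotProduct_self_of_mem_diffs (hmem p x hx)
    pair := fun p x y hx hy hxy ↦
      hG.dotProduct_of_mem_diffs (hmem p x hx) (hmem p y hy) ((hinj p).ne hxy)
    orth := fun p q x y hpq hx hy ↦ dotProduct_eq_zero_of_mem_diffs
      (fun h ↦ hpq (Subtype.ext h)) (hmem p x hx) (hmem q y hy) }, fun _ ↦ rfl, hcard⟩

theorem false (hG : MinimalCounterexample G) : False := by
  obtain ⟨T⟩ := nonempty_characterTable G
  obtain ⟨F, hf, hX⟩ := hG.exists_coherentFamily T
  have hp : ∀ p : (Nat.card G).primeFactors, (p : ℕ).Prime := fun p ↦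
    Nat.prime_of_mem_primeFactors p.2
  have hpG : ∀ p : (Nat.card G).primeFactors, (p : ℕ) ∣ Nat.card G := fun p ↦
    Nat.dvd_of_mem_primeFactors p.2
  have h := sum_inv_le_one (f := F.f) (w := fun p ↦ (F.X p).card) (c := F.c)
    (fun p ↦ (hG.three_le_sylowIndex (hp p) (hpG p)).trans_eq (hf p).symm)
    (fun p ↦ hf p ▸ hG.odd_sylowIndex p) F.two_le
    (fun p ↦ hX p ▸ hG.even_card_diffs T (hp p) (hpG p))
    (fun p q hpq ↦ by
      obtain ⟨k, hk, hk'⟩ := hG.exists_card_diffs T (hp p) (hpG p)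
      obtain ⟨l, hl, hl'⟩ := hG.exists_card_diffs T (hp q) (hpG q)
      simp only [hX, hf] at hpq
      rw [hpq, hl'] at hk'
      exact Subtype.ext ((Nat.prime_dvd_prime_iff_eq (hp p) (hp q)).1
        ((hp p).dvd_of_dvd_pow (hk' ▸ dvd_pow_self _ hk))))
    F.c_ne_zero_or F.sum_card_mul_sq_le F.sum_div_le
  simp_rw [hf] at h
  rw [Finset.sum_coe_sort _ fun p ↦ ((sylowIndex G p : ℚ))⁻¹] at h
  exact h.not_gt hG.one_lt_sum_inv_sylowIndex

end

end MinimalCounterexample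

/-- A nontrivial finite group with the basis property has a nontrivial normal `p`-subgroup. -/
theorem exists_normal_isPGroup {G : Type*} [Group G] [Finite G] [Nontrivial G] (hG : RelBasis G) :
    ∃ (p : ℕ) (N : Subgroup G), p.Prime ∧ N.Normal ∧ IsPGroup p N ∧ N ≠ ⊥ := by
  induction hn : Nat.card G using Nat.strong_induction_on generalizing G with
  | _ n ih =>
    by_contra! h
    refine MinimalCounterexample.false (G := G) ⟨hG, ‹_›, h, fun H hH hH' ↦ ?_⟩
    have := (nontrivial_iff_ne_bot H).2 hH'
    have hlt : Nat.card H < n := hn ▸ lt_of_le_of_ne (card_le_card_group H) fun h ↦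
      hH (eq_top_of_card_eq H h)
    obtain ⟨p, N, hp, hN, hNp, hne⟩ := ih _ hlt (hG.subgroup H) rfl
    refine ⟨p, N.map H.subtype, hp, hNp.map _, ?_, map_subtype_le N, ?_⟩
    · rwa [Ne, (map_eq_bot_iff_of_injective N H.subtype_injective)]
    · have := le_normalizer_map (H := N) H.subtype
      rwa [normalizer_eq_top, ← MonoidHom.range_eq_map, range_subtype] at this

end BasisProperty

open scoped Pointwise in
theorem basis_property_classification (G : Type*) [Group G] [Finite G]
    (hbasis : ∀ H : Subgroup G, HasPropB H)
    (hnp : ¬ ∃ p k : ℕ, p.Prime ∧ Nat.card G = p ^ k) :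
    ∃ p q : ℕ, p.Prime ∧ q.Prime ∧ p ≠ q ∧
    ∃ P Q : Subgroup G, P.Normal ∧
      IsPGroup p P ∧ ¬ p ∣ P.index ∧
      Q ≠ ⊥ ∧ IsCyclic Q ∧ IsPGroup q Q ∧ ¬ q ∣ Q.index ∧
      P ⊓ Q = ⊥ ∧ (P : Set G) * (Q : Set G) = Set.univ ∧
      (∀ y ∈ Q, y ≠ 1 → ∀ u ∈ P, y * u * y⁻¹ = u → u = 1) := by
  have hG := BasisProperty.relBasis_of_hasPropB hbasis
  have : Nontrivial G := by
    rw [← Finite.one_lt_card_iff_nontrivial]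
    refine lt_of_le_of_ne Nat.card_pos fun h ↦ hnp ⟨2, 0, Nat.prime_two, ?_⟩
    rw [← h, pow_zero]
  obtain ⟨p, N, hp, hN, hNp, hne⟩ := BasisProperty.exists_normal_isPGroup hG
  obtain ⟨P, hP, hPp, hPi, hPQ⟩ := BasisProperty.exists_frobenius hG hp hNp hne
  have := Fact.mk hp
  rcases hPQ with rfl | ⟨q, hq, hpq, Q, hQ, hQc, hQq, hQi, hPQ⟩
  · obtain ⟨k, hk⟩ := IsPGroup.iff_card.1 hPp
    exact (hnp ⟨p, k, hp, by rwa [Subgroup.card_top] at hk⟩).elim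
  · refine ⟨p, q, hp, hq, hpq, P, Q, hP, hPp, hPi, hQ, hQc, hQq, hQi, hPQ.disjoint.eq_bot,
      hPQ.mul_eq, fun y hy hy1 u hu h ↦ ?_⟩
    exact (BasisProperty.eq_one_of_commute hG (mul_inv_eq_iff_eq_mul.1 h).symm
      (BasisProperty.coprime_orderOf hp hq hpq hPp hQq hu hy)).resolve_right hy1
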